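/- arXiv:2402.04942 — 10 statements merged into one kernel-verified Lean document; each statement's English description precedes it below -/
import Mathlib

section
/- Let p, q : ℝ → ℝ be probability density functions (nonnegative, measurable, integrating to 1) that are symmetric (p(−x) = p(x), q(−x) = q(x) for all x) and unimodal (p and q are nonincreasing on [0, ∞)). Then the convolution p∗q, defined by (p∗q)(x) = ∫_ℝ p(y) q(x−y) dy, is a symmetric unimodal probability density function: (p∗q)(−x) = (p∗q)(x) for all x, and p∗q is nonincreasing on [0, ∞). -/
open MeasureTheory

/-- A symmetric function that is nonincreasing on `[0, ∞)` is nonincreasing in `|x|`. -/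
theorem le_of_abs_le_of_symmetric_antitoneOn {f : ℝ → ℝ} (hs : ∀ x : ℝ, f (-x) = f x)
    (hu : AntitoneOn f (Set.Ici (0 : ℝ))) {x y : ℝ} (h : |x| ≤ |y|) : f y ≤ f x := by
  have habs : ∀ z : ℝ, f |z| = f z := fun z => by
    rcases abs_choice z with hz | hz <;> rw [hz]
    exact hs z
  rw [← habs x, ← habs y]
  exact hu (abs_nonneg x) (abs_nonneg y) h

/-- Rearrangement inequality for the values of two symmetric unimodal functions at points
exchanged by the reflection `y ↦ a + b - y`. -/
theorem symmetric_unimodal_rearrangement {p q : ℝ → ℝ}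
    (hps : ∀ x : ℝ, p (-x) = p x) (hqs : ∀ x : ℝ, q (-x) = q x)
    (hpu : AntitoneOn p (Set.Ici (0 : ℝ))) (hqu : AntitoneOn q (Set.Ici (0 : ℝ)))
    {a b : ℝ} (ha : 0 ≤ a) (hab : a ≤ b) (y : ℝ) :
    p y * q (b - y) + p (a + b - y) * q (b - (a + b - y))
      ≤ p y * q (a - y) + p (a + b - y) * q (a - (a + b - y)) := by
  have h1 : q (b - (a + b - y)) = q (a - y) := by
    rw [← hqs]; congr 1; ring
  have h2 : q (a - (a + b - y)) = q (b - y) := by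
    rw [← hqs]; congr 1; ring
  rw [h1, h2]
  rcases le_total (2 * y) (a + b) with hy | hy
  · have hp : p (a + b - y) ≤ p y :=
      le_of_abs_le_of_symmetric_antitoneOn hps hpu (sq_le_sq.mp (by nlinarith))
    have hq : q (b - y) ≤ q (a - y) :=
      le_of_abs_le_of_symmetric_antitoneOn hqs hqu (sq_le_sq.mp (by nlinarith))
    nlinarith [mul_nonneg (sub_nonneg.mpr hp) (sub_nonneg.mpr hq)]
  · have hp : p y ≤ p (a + b - y) :=
      le_of_abs_le_of_symmetric_antitoneOn hps hpu (sq_le_sq.mp (by nlinarith))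
    have hq : q (a - y) ≤ q (b - y) :=
      le_of_abs_le_of_symmetric_antitoneOn hqs hqu (sq_le_sq.mp (by nlinarith))
    nlinarith [mul_nonneg (sub_nonneg.mpr hp) (sub_nonneg.mpr hq)]

/-- The `ℝ≥0∞`-valued integral of a nonnegative function with Bochner integral `1` is `1`. -/
theorem lintegral_ofReal_eq_one {f : ℝ → ℝ} (h0 : ∀ x : ℝ, 0 ≤ f x)
    (h1 : (∫ x : ℝ, f x) = 1) : ∫⁻ x : ℝ, ENNReal.ofReal (f x) = 1 := by
  have hi : Integrable f := .of_integral_ne_zero (by rw [h1]; exact one_ne_zero)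
  rw [← ofReal_integral_eq_lintegral_ofReal hi (.of_forall h0), h1, ENNReal.ofReal_one]

/-- Comparing two functions after averaging over a reflection compares their integrals. -/
theorem lintegral_le_of_add_reflect_le {f g : ℝ → ENNReal} (hf : Measurable f)
    (hg : Measurable g) (c : ℝ) (h : ∀ y : ℝ, f y + f (c - y) ≤ g y + g (c - y)) :
    ∫⁻ y : ℝ, f y ≤ ∫⁻ y : ℝ, g y := by
  have key := lintegral_mono (μ := (volume : Measure ℝ)) h
  rw [lintegral_add_left hf, lintegral_add_left hg, lintegral_sub_left_eq_self f c,
    lintegral_sub_left_eq_self g c, ← two_mul, ← two_mul] at key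
  exact (ENNReal.mul_le_mul_iff_right two_ne_zero ENNReal.ofNat_ne_top).mp key

/-- The convolution of two symmetric unimodal probability density functions is a
symmetric unimodal probability density function.  (The convolution is taken as a
Lebesgue integral with values in `ℝ≥0∞`, since the pointwise convolution of two
densities may be infinite at isolated points.) -/
theorem convolution_of_symmetric_unimodal_pdfs
    (p q : ℝ → ℝ) (hpm : Measurable p) (hqm : Measurable q)
    (hp0 : ∀ x : ℝ, 0 ≤ p x) (hq0 : ∀ x : ℝ, 0 ≤ q x)
    (hp1 : (∫ x : ℝ, p x) = 1) (hq1 : (∫ x : ℝ, q x) = 1)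
    (hps : ∀ x : ℝ, p (-x) = p x) (hqs : ∀ x : ℝ, q (-x) = q x)
    (hpu : AntitoneOn p (Set.Ici (0 : ℝ))) (hqu : AntitoneOn q (Set.Ici (0 : ℝ))) :
    (∀ x : ℝ,
        (∫⁻ y : ℝ, ENNReal.ofReal (p y * q (-x - y)))
          = ∫⁻ y : ℝ, ENNReal.ofReal (p y * q (x - y)))
      ∧ AntitoneOn (fun x : ℝ => ∫⁻ y : ℝ, ENNReal.ofReal (p y * q (x - y)))
          (Set.Ici (0 : ℝ))
      ∧ (∫⁻ x : ℝ, ∫⁻ y : ℝ, ENNReal.ofReal (p y * q (x - y))) = 1 := by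
  refine ⟨fun x => ?_, fun a ha b _ hab => ?_, ?_⟩
  · rw [← lintegral_neg_eq_self]
    refine lintegral_congr fun y => ?_
    rw [hps, ← hqs (x - y)]
    congr 3
    ring
  · refine lintegral_le_of_add_reflect_le (by fun_prop) (by fun_prop) (a + b) fun y => ?_
    have hpq : ∀ u v : ℝ, 0 ≤ p u * q v := fun u v => mul_nonneg (hp0 u) (hq0 v)
    rw [← ENNReal.ofReal_add (hpq _ _) (hpq _ _), ← ENNReal.ofReal_add (hpq _ _) (hpq _ _)]
    exact ENNReal.ofReal_le_ofReal
      (symmetric_unimodal_rearrangement hps hqs hpu hqu ha hab y)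
  · rw [lintegral_lintegral_swap (by fun_prop), ← lintegral_ofReal_eq_one hp0 hp1]
    refine lintegral_congr fun y => ?_
    simp_rw [ENNReal.ofReal_mul (hp0 y)]
    rw [lintegral_const_mul _ (by fun_prop),
      lintegral_sub_right_eq_self (fun x => ENNReal.ofReal (q x)) y,
      lintegral_ofReal_eq_one hq0 hq1, mul_one]
end

section
/- Let f : ℝ → ℝ be nonnegative, symmetric (f(−x) = f(x)) and unimodal (nonincreasing on [0, ∞)). Let A > 0 be real, M ≥ 1 an integer, and let x satisfy 0 ≤ x < A/(2M). Then | ∫_{−A/2}^{A/2} f(y) dy − Σ_{k=−⌊M/2⌋}^{⌈M/2⌉−1} (A/M) f(x + k·A/M) | ≤ (A/M) f(0). -/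
open MeasureTheory

theorem sum_Icc_neg_natCast (g : ℤ → ℝ) (n q : ℕ) :
    ∑ k ∈ Finset.Icc (-(n : ℤ)) q, g k
      = ∑ i ∈ Finset.range (q + 1), g i + ∑ j ∈ Finset.range n, g (-((j : ℤ) + 1)) := by
  induction n with
  | zero =>
    induction q with
    | zero => simp
    | succ q ih =>
      have h : Finset.Icc (-((0 : ℕ) : ℤ)) ((q + 1 : ℕ) : ℤ)
          = insert ((q + 1 : ℕ) : ℤ) (Finset.Icc (-((0 : ℕ) : ℤ)) q) := by
        ext k; simp only [Finset.mem_Icc, Finset.mem_insert]; omega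
      rw [h, Finset.sum_insert (by simp), ih, Finset.sum_range_succ _ (q + 1)]
      ring
  | succ n ih =>
    have h : Finset.Icc (-((n + 1 : ℕ) : ℤ)) (q : ℤ)
        = insert (-((n : ℤ) + 1)) (Finset.Icc (-(n : ℤ)) q) := by
      ext k; simp only [Finset.mem_Icc, Finset.mem_insert]; omega
    rw [h, Finset.sum_insert (by simp), ih, Finset.sum_range_succ _ n]
    ring

theorem AntitoneOn.intervalIntegrable_of_even {f : ℝ → ℝ} (hfu : AntitoneOn f (Set.Ici 0))
    (hfs : ∀ x, f (-x) = f x) (a b : ℝ) : IntervalIntegrable f volume a b := by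
  have pos : ∀ c, 0 ≤ c → IntervalIntegrable f volume 0 c := fun c hc =>
    (hfu.mono (by rw [Set.uIcc_of_le hc]; exact Set.Icc_subset_Ici_self)).intervalIntegrable
  have zero : ∀ c, IntervalIntegrable f volume 0 c := fun c => by
    rcases le_total 0 c with hc | hc
    · exact pos c hc
    · have h := (IntervalIntegrable.iff_comp_neg (f := f)).mp (pos (-c) (by linarith))
      simpa [hfs] using h
  exact (zero a).symm.trans (zero b)

section

variable {f : ℝ → ℝ}

theorem AntitoneOn.mul_le_integral_le_mul (hfu : AntitoneOn f (Set.Ici 0)) {a b : ℝ}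
    (ha : 0 ≤ a) (hab : a ≤ b) :
    (b - a) * f b ≤ ∫ y in a..b, f y ∧ ∫ y in a..b, f y ≤ (b - a) * f a := by
  have hi : IntervalIntegrable f volume a b :=
    (hfu.mono (by
      rw [Set.uIcc_of_le hab]; exact fun y hy => ha.trans hy.1)).intervalIntegrable
  constructor
  · have h := intervalIntegral.integral_mono_on (f := fun _ => f b) hab
      intervalIntegrable_const hi
      (fun y hy => hfu (ha.trans hy.1) (ha.trans hab) hy.2)
    simpa using h
  · have h := intervalIntegral.integral_mono_on (g := fun _ => f a) hab
      hi intervalIntegrable_const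
      (fun y hy => hfu ha (ha.trans hy.1) hy.1)
    simpa using h

theorem AntitoneOn.riemann_sum_bounds (hfu : AntitoneOn f (Set.Ici 0)) {a h : ℝ}
    (ha : 0 ≤ a) (hh : 0 ≤ h) (n : ℕ) :
    ∑ i ∈ Finset.range n, h * f (a + (i + 1) * h) ≤ ∫ y in a..(a + n * h), f y ∧
      ∫ y in a..(a + n * h), f y ≤ ∑ i ∈ Finset.range n, h * f (a + i * h) := by
  induction n with
  | zero => simp
  | succ n ih =>
    have hn : 0 ≤ (n : ℝ) * h := by positivity
    have hi : ∀ c d : ℝ, a ≤ c → c ≤ d → IntervalIntegrable f volume c d := fun c d hc hd =>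
      (hfu.mono (by
        rw [Set.uIcc_of_le hd]; exact fun y hy => (ha.trans hc).trans hy.1)).intervalIntegrable
    have hstep : a + n * h ≤ a + (n + 1) * h := by linarith
    obtain ⟨h1, h2⟩ := hfu.mul_le_integral_le_mul (add_nonneg ha hn) hstep
    rw [show a + (n + 1) * h - (a + n * h) = h by ring] at h1 h2
    rw [Finset.sum_range_succ, Finset.sum_range_succ]
    push_cast
    rw [← intervalIntegral.integral_add_adjacent_intervals
      (hi a (a + n * h) le_rfl (by linarith)) (hi _ _ (by linarith) hstep)]
    exact ⟨add_le_add ih.1 h1, add_le_add ih.2 h2⟩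

end

/-- Riemann-sum bound for samples of a symmetric unimodal function (Lemma 3,
bound (7), of the paper): the Riemann sum with spacing `A/M` and offset
`0 ≤ x < A/(2M)` differs from the integral over `[-A/2, A/2]` by at most
`(A/M) f(0)`. -/
theorem symmetric_unimodal_riemann_sum_bound
    (f : ℝ → ℝ) (hf0 : ∀ x : ℝ, 0 ≤ f x)
    (hfs : ∀ x : ℝ, f (-x) = f x)
    (hfu : AntitoneOn f (Set.Ici (0 : ℝ)))
    (A : ℝ) (hA : 0 < A) (M : ℕ) (hM : 1 ≤ M)
    (x : ℝ) (hx0 : 0 ≤ x) (hx1 : x < A / (2 * M)) :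
    |(∫ y in (-(A / 2))..(A / 2), f y)
        - ∑ k ∈ Finset.Icc (-((M : ℤ) / 2)) (((M : ℤ) + 1) / 2 - 1),
            (A / M) * f (x + (k : ℝ) * (A / M))|
      ≤ (A / M) * f 0 := by
  have hM' : (0 : ℝ) < M := by exact_mod_cast hM
  obtain ⟨n, hn⟩ : ∃ n : ℕ, n = M / 2 := ⟨_, rfl⟩
  obtain ⟨q, hq⟩ : ∃ q : ℕ, q = (M + 1) / 2 - 1 := ⟨_, rfl⟩
  have hnM : (M : ℤ) / 2 = n := by omega
  have hqM : ((M : ℤ) + 1) / 2 - 1 = q := by omega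
  have hn1 : 2 * (n : ℝ) ≤ M := by exact_mod_cast (by omega : 2 * n ≤ M)
  have hn2 : (M : ℝ) ≤ 2 * n + 1 := by exact_mod_cast (by omega : M ≤ 2 * n + 1)
  have hq1 : 2 * (q : ℝ) + 1 ≤ M := by exact_mod_cast (by omega : 2 * q + 1 ≤ M)
  have hq2 : (M : ℝ) ≤ 2 * q + 2 := by exact_mod_cast (by omega : M ≤ 2 * q + 2)
  rw [hnM, hqM, sum_Icc_neg_natCast]
  obtain ⟨h, hh⟩ : ∃ h : ℝ, h = A / M := ⟨_, rfl⟩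
  have hpos : 0 < h := by rw [hh]; positivity
  have hAh : A = M * h := by rw [hh]; field_simp
  have hxh : x < h / 2 := by
    rw [hh, div_div, mul_comm (M : ℝ)]; exact hx1
  rw [← hh]
  have hint := hfu.intervalIntegrable_of_even hfs
  obtain ⟨F, hF⟩ : ∃ F : ℝ → ℝ, ∀ t, F t = ∫ y in (0 : ℝ)..t, f y := ⟨_, fun _ => rfl⟩
  have hFsub : ∀ a b, ∫ y in a..b, f y = F b - F a := fun a b => by
    rw [hF, hF, intervalIntegral.integral_interval_sub_left (hint 0 b) (hint 0 a)]
  have hFmono : ∀ a b, a ≤ b → F a ≤ F b := fun a b hab => by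
    have := intervalIntegral.integral_nonneg (μ := volume) hab fun y _ => hf0 y
    rw [hFsub] at this
    linarith
  have hFneg : ∀ t, F (-t) = -F t := fun t => by
    have := intervalIntegral.integral_comp_neg (a := 0) (b := t) f
    simp only [hfs, neg_zero] at this
    rw [hF, hF, this, intervalIntegral.integral_symm]
  have hF0 : F 0 = 0 := by simp [hF]
  have hFle : ∀ t, 0 ≤ t → F t ≤ t * f 0 := fun t ht => by
    simpa [hFsub, hF0] using (hfu.mul_le_integral_le_mul le_rfl ht).2
  have hleF : ∀ t, 0 ≤ t → t * f t ≤ F t := fun t ht => by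
    simpa [hFsub, hF0] using (hfu.mul_le_integral_le_mul le_rfl ht).1
  have hneg : ∀ j : ℕ, f (x + ((-((j : ℤ) + 1) : ℤ) : ℝ) * h) = f (h - x + j * h) := fun j => by
    rw [← hfs]; congr 1; push_cast; ring
  simp only [hneg, Int.cast_natCast]
  have hhx : 0 ≤ h - x := by linarith
  have lowerPos := (hfu.riemann_sum_bounds hx0 hpos.le (q + 1)).2
  have lowerNeg := (hfu.riemann_sum_bounds hhx hpos.le n).2
  have upperPos : ∑ i ∈ Finset.range (q + 1), h * f (x + i * h)
      ≤ h * f 0 + (F (x + q * h) - F x) := by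
    have hu := (hfu.riemann_sum_bounds hx0 hpos.le q).1
    have hfx : h * f x ≤ h * f 0 :=
      mul_le_mul_of_nonneg_left (hfu Set.self_mem_Ici hx0 hx0) hpos.le
    rw [hFsub] at hu
    rw [Finset.sum_range_succ']
    push_cast
    simp only [zero_mul, add_zero]
    linarith
  have upperNeg : ∑ j ∈ Finset.range n, h * f (h - x + j * h) ≤ F x + F (n * h - x) := by
    rcases n with _ | m
    · simp [hFneg]
    · have hu := (hfu.riemann_sum_bounds hhx hpos.le m).1
      have hxf : x * f (h - x) ≤ x * f x :=
        mul_le_mul_of_nonneg_left (hfu hx0 hhx (by linarith)) hx0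
      have h1 := hleF x hx0
      have h2 := hleF (h - x) hhx
      rw [hFsub] at hu
      rw [Finset.sum_range_succ']
      push_cast
      simp only [zero_mul, add_zero]
      rw [show ((m : ℝ) + 1) * h - x = h - x + m * h by ring]
      linarith
  rw [hFsub] at lowerPos lowerNeg
  push_cast at lowerPos
  rw [hFsub, hFneg]
  have e1 := hFmono (A / 2) (x + (q + 1) * h) (by nlinarith)
  have e2 := hFmono (A / 2) (h - x + n * h) (by nlinarith)
  have e3 := hFmono (x + q * h) (A / 2) (by nlinarith)
  have e4 := hFmono (n * h - x) (A / 2) (by nlinarith)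
  have e5 := hFle x hx0
  have e6 := hFle (h - x) hhx
  rw [abs_le]
  constructor <;> linarith
end

section
/- Let f : ℝ → ℝ be nonnegative, symmetric (f(−x) = f(x)), unimodal (nonincreasing on [0, ∞)), and Lebesgue integrable on ℝ. Let A > 0 be real and M ≥ 1 an integer. Then for every x ∈ ℝ, the sum Σ_{k∈ℤ} (A/M) f(x + k·A/M) converges and | ∫_ℝ f(y) dy − Σ_{k∈ℤ} (A/M) f(x + k·A/M) | ≤ (A/M) f(0). -/
open MeasureTheory

/-- Comparison of the integral over a half-line of an antitone nonnegative integrable function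
with the sum of its samples at unit spacing. -/
lemma AntitoneOn.summable_and_integral_Ioi_bounds {g : ℝ → ℝ} {a : ℝ} (hg0 : ∀ x, 0 ≤ g x)
    (hg : AntitoneOn g (Set.Ici a)) (hgi : IntegrableOn g (Set.Ioi a)) :
    Summable (fun n : ℕ => g (a + n)) ∧
      (∑' n : ℕ, g (a + n)) - g a ≤ ∫ y in Set.Ioi a, g y ∧
      ∫ y in Set.Ioi a, g y ≤ ∑' n : ℕ, g (a + n) := by
  have hanti (n : ℕ) : AntitoneOn g (Set.Icc a (a + n)) := hg.mono fun y hy => hy.1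
  have hlow (n : ℕ) : ∑ i ∈ Finset.range n, g (a + (i + 1 : ℕ)) ≤ ∫ y in Set.Ioi a, g y := by
    refine (hanti n).sum_le_integral.trans ?_
    rw [intervalIntegral.integral_of_le (by simp)]
    exact setIntegral_mono_set hgi (.of_forall hg0) Set.Ioc_subset_Ioi_self.eventuallyLE
  have hsum' : Summable (fun n : ℕ => g (a + (n + 1 : ℕ))) :=
    summable_of_sum_range_le (fun _ => hg0 _) hlow
  have hsum : Summable (fun n : ℕ => g (a + n)) :=
    (summable_nat_add_iff (f := fun n : ℕ => g (a + n)) 1).1 hsum'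
  refine ⟨hsum, ?_, ?_⟩
  · have h := Real.tsum_le_of_sum_range_le (fun _ => hg0 _) hlow
    rw [hsum.tsum_eq_zero_add]
    simpa using h
  · have hlim := intervalIntegral_tendsto_integral_Ioi a hgi
      (Filter.tendsto_atTop_add_const_left _ a tendsto_natCast_atTop_atTop)
    exact le_of_tendsto hlim (.of_forall fun n => (hanti n).integral_le_sum.trans
      (hsum.sum_le_tsum _ fun _ _ => hg0 _))

/-- A symmetric unimodal function is bounded below on `[-b, a]` by the smaller of its values at
the endpoints. -/
lemma min_le_of_symmetric_unimodal {f : ℝ → ℝ} (hfs : ∀ x : ℝ, f (-x) = f x)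
    (hfu : AntitoneOn f (Set.Ici (0 : ℝ))) {a b y : ℝ} (ha : 0 ≤ a) (hb : 0 ≤ b)
    (hya : y ≤ a) (hyb : -b ≤ y) : min (f a) (f b) ≤ f y := by
  rcases le_total 0 y with hy | hy
  · exact (min_le_left _ _).trans (hfu hy ha hya)
  · rw [← hfs y]
    exact (min_le_right _ _).trans (hfu (neg_nonneg.2 hy) hb (by linarith))

/-- A symmetric unimodal function attains its maximum at the origin. -/
lemma le_zero_of_symmetric_unimodal {f : ℝ → ℝ} (hfs : ∀ x : ℝ, f (-x) = f x)
    (hfu : AntitoneOn f (Set.Ici (0 : ℝ))) (y : ℝ) : f y ≤ f 0 := by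
  rcases le_total 0 y with hy | hy
  · exact hfu Set.self_mem_Ici hy hy
  · rw [← hfs y]
    exact hfu Set.self_mem_Ici (neg_nonneg.2 hy) (neg_nonneg.2 hy)

/-- The Riemann-sum bound at unit spacing, for an offset in `[0, 1]`. -/
lemma symmetric_unimodal_sum_bound_of_mem_Icc {f : ℝ → ℝ} (hf0 : ∀ x : ℝ, 0 ≤ f x)
    (hfs : ∀ x : ℝ, f (-x) = f x) (hfu : AntitoneOn f (Set.Ici (0 : ℝ))) (hfi : Integrable f)
    {a : ℝ} (ha : 0 ≤ a) (ha' : a ≤ 1) :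
    Summable (fun k : ℤ => f (a + k)) ∧ |(∫ y, f y) - ∑' k : ℤ, f (a + k)| ≤ f 0 := by
  have hb : 0 ≤ 1 - a := sub_nonneg.2 ha'
  obtain ⟨hs₁, hl₁, hu₁⟩ := AntitoneOn.summable_and_integral_Ioi_bounds hf0
    (hfu.mono (Set.Ici_subset_Ici.2 ha)) hfi.integrableOn
  obtain ⟨hs₂, hl₂, hu₂⟩ := AntitoneOn.summable_and_integral_Ioi_bounds hf0
    (hfu.mono (Set.Ici_subset_Ici.2 hb)) hfi.integrableOn
  have hneg (n : ℕ) : f (1 - a + n) = f (a + ((-(n + 1) : ℤ) : ℝ)) := by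
    rw [← hfs]
    congr 1
    push_cast
    ring
  have hsum : HasSum (fun k : ℤ => f (a + k)) ((∑' n : ℕ, f (a + n)) + ∑' n : ℕ, f (1 - a + n)) := by
    refine HasSum.of_nat_of_neg_add_one (by simpa using hs₁.hasSum) ?_
    simpa only [← hneg] using hs₂.hasSum
  refine ⟨hsum.summable, ?_⟩
  rw [hsum.tsum_eq]
  have hleft : ∫ y in Set.Iic (a - 1), f y = ∫ y in Set.Ioi (1 - a), f y := by
    rw [← neg_sub 1 a, ← integral_comp_neg_Ioi]
    simp only [hfs]
  have hmid : (∫ y in Set.Iic a, f y) - ∫ y in Set.Iic (a - 1), f y = ∫ y in (a - 1)..a, f y :=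
    intervalIntegral.integral_Iic_sub_Iic hfi.integrableOn hfi.integrableOn
  have hsplit : (∫ y in Set.Iic a, f y) + ∫ y in Set.Ioi a, f y = ∫ y, f y :=
    intervalIntegral.integral_Iic_add_Ioi hfi.integrableOn hfi.integrableOn
  have hmid_le : ∫ y in (a - 1)..a, f y ≤ f 0 := by
    have h := intervalIntegral.integral_mono_on (a := a - 1) (b := a) (by linarith)
      hfi.intervalIntegrable (intervalIntegrable_const (c := f 0))
      fun y _ => le_zero_of_symmetric_unimodal hfs hfu y
    simpa using h
  have hle_mid : min (f a) (f (1 - a)) ≤ ∫ y in (a - 1)..a, f y := by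
    have h := intervalIntegral.integral_mono_on (a := a - 1) (b := a) (by linarith)
      (intervalIntegrable_const (c := min (f a) (f (1 - a)))) hfi.intervalIntegrable
      fun y hy => min_le_of_symmetric_unimodal hfs hfu ha hb hy.2 (by linarith [hy.1])
    simpa using h
  have hmax : max (f a) (f (1 - a)) ≤ f 0 := max_le
    (le_zero_of_symmetric_unimodal hfs hfu _) (le_zero_of_symmetric_unimodal hfs hfu _)
  have hminmax := min_add_max (f a) (f (1 - a))
  rw [abs_le]
  constructor <;> linarith

/-- The Riemann-sum bound at unit spacing, for an arbitrary offset. -/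
lemma symmetric_unimodal_sum_bound {f : ℝ → ℝ} (hf0 : ∀ x : ℝ, 0 ≤ f x)
    (hfs : ∀ x : ℝ, f (-x) = f x) (hfu : AntitoneOn f (Set.Ici (0 : ℝ))) (hfi : Integrable f)
    (x : ℝ) :
    Summable (fun k : ℤ => f (x + k)) ∧ |(∫ y, f y) - ∑' k : ℤ, f (x + k)| ≤ f 0 := by
  obtain ⟨hs, hb⟩ := symmetric_unimodal_sum_bound_of_mem_Icc hf0 hfs hfu hfi
    (Int.fract_nonneg x) (Int.fract_lt_one x).le
  have hshift : (fun k : ℤ => f (x + k)) =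
      (fun k : ℤ => f (Int.fract x + k)) ∘ Equiv.addLeft ⌊x⌋ := by
    funext k
    simp only [Function.comp_apply, Equiv.coe_addLeft]
    push_cast
    rw [← add_assoc, Int.fract_add_floor]
  refine ⟨hshift ▸ (Equiv.addLeft ⌊x⌋).summable_iff.2 hs, ?_⟩
  have htsum := (Equiv.addLeft ⌊x⌋).tsum_eq (fun k : ℤ => f (Int.fract x + k))
  rwa [hshift, Function.comp_def, htsum]

/-- Riemann-sum bound over all of `ℝ` for samples of an integrable symmetric
unimodal function (Lemma 3, bound (8), of the paper): for any offset `x`, the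
sum over all integer shifts converges and differs from the integral over `ℝ` by
at most `(A/M) f(0)`. -/
theorem symmetric_unimodal_riemann_sum_bound_integers
    (f : ℝ → ℝ) (hf0 : ∀ x : ℝ, 0 ≤ f x)
    (hfs : ∀ x : ℝ, f (-x) = f x)
    (hfu : AntitoneOn f (Set.Ici (0 : ℝ)))
    (hfi : Integrable f)
    (A : ℝ) (hA : 0 < A) (M : ℕ) (hM : 1 ≤ M) :
    ∀ x : ℝ,
      Summable (fun k : ℤ => (A / M) * f (x + (k : ℝ) * (A / M)))
      ∧ |(∫ y : ℝ, f y) - ∑' k : ℤ, (A / M) * f (x + (k : ℝ) * (A / M))|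
          ≤ (A / M) * f 0 := by
  intro x
  have hM' : (0 : ℝ) < M := by exact_mod_cast hM
  have hh : 0 < A / M := div_pos hA hM'
  generalize A / M = h at hh ⊢
  obtain ⟨hs, hb⟩ := symmetric_unimodal_sum_bound (f := fun y => f (h * y)) (fun _ => hf0 _)
    (fun y => by rw [mul_neg, hfs])
    (fun y hy z hz hyz => hfu (mul_nonneg hh.le hy) (mul_nonneg hh.le hz)
      (mul_le_mul_of_nonneg_left hyz hh.le))
    (hfi.comp_mul_left' hh.ne') (x / h)
  have hpt (k : ℤ) : h * (x / h + k) = x + k * h := by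
    field_simp
  simp only [hpt, mul_zero] at hs hb
  refine ⟨hs.mul_left h, ?_⟩
  rw [Measure.integral_comp_mul_left, abs_of_pos (inv_pos.2 hh), smul_eq_mul] at hb
  rw [tsum_mul_left]
  calc |(∫ y, f y) - h * ∑' k : ℤ, f (x + k * h)|
      = h * |h⁻¹ * (∫ y, f y) - ∑' k : ℤ, f (x + k * h)| := by
        rw [← abs_of_nonneg (mul_nonneg hh.le (abs_nonneg _)), abs_mul, abs_abs, ← abs_mul,
          mul_sub, mul_inv_cancel_left₀ hh.ne']
    _ ≤ h * f 0 := mul_le_mul_of_nonneg_left hb hh.le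
end

section
/- Let q : ℝ → ℝ be a probability density function that is symmetric (q(−x) = q(x)), unimodal (nonincreasing on [0, ∞)), and vanishes outside [−A/2, A/2), where A > 0. Let M ≥ 1 be an integer and define d(x) = Σ_{k=0}^{M−1} (A/M) q( (x + k·A/M) mod A ). Then for every x ∈ ℝ, 1 − (A/M) q(0) ≤ d(x) ≤ 1 + (A/M) q(0). -/
open MeasureTheory

/-- `smod x A` is the representative of `x` modulo `A` in `[-A/2, A/2)`,
i.e. `x - k' A` where `k'` is the unique integer with `x - k' A ∈ [-A/2, A/2)`.
(For `A > 0`, `round (x / A)` is exactly this integer `k'`.) -/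
noncomputable def smod (x A : ℝ) : ℝ := x - A * (round (x / A) : ℤ)

lemma smod_periodic {A : ℝ} (hA : 0 < A) : Function.Periodic (fun x => smod x A) A := by
  intro x
  simp only [smod]
  rw [add_div, div_self hA.ne', round_add_one]
  push_cast
  ring

lemma smod_eq_self {A y : ℝ} (hA : 0 < A) (h₀ : 0 ≤ y) (h₁ : y < A / 2) : smod y A = y := by
  have h : round (y / A) = 0 := by
    rw [round_eq, Int.floor_eq_zero_iff]
    have h2 : y / A < 1 / 2 := by rw [div_lt_iff₀ hA]; linarith
    exact ⟨by positivity, by linarith⟩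
  simp [smod, h]

lemma smod_eq_sub {A y : ℝ} (hA : 0 < A) (h₀ : A / 2 ≤ y) (h₁ : y < A) :
    smod y A = y - A := by
  have h : round (y / A) = 1 := by
    rw [round_eq, Int.floor_eq_iff]
    have h2 : y / A < 1 := by rwa [div_lt_one hA]
    have h3 : 1 / 2 ≤ y / A := by rw [le_div_iff₀ hA]; linarith
    push_cast
    exact ⟨by linarith, by linarith⟩
  simp [smod, h]

/-- Sampling a function of period `M * h` at `M` points of step `h` gives a sum of period `h`. -/
lemma sum_range_step_periodic {f : ℝ → ℝ} {h : ℝ} {M : ℕ} (hf : Function.Periodic f (M * h)) :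
    Function.Periodic (fun x => ∑ k ∈ Finset.range M, f (x + k * h)) h := by
  intro x
  have h₁ := Finset.sum_range_succ (fun k : ℕ => f (x + k * h)) M
  have h₂ := Finset.sum_range_succ' (fun k : ℕ => f (x + k * h)) M
  simp only [hf x, Nat.cast_zero, zero_mul, add_zero] at h₁ h₂
  have h₃ : ∑ k ∈ Finset.range M, f (x + h + k * h)
      = ∑ k ∈ Finset.range M, f (x + (k + 1 : ℕ) * h) :=
    Finset.sum_congr rfl fun k _ => by congr 1; push_cast; ring
  simp only [h₃]
  linarith

lemma comp_smod_eq_add {q : ℝ → ℝ} {A y : ℝ} (hA : 0 < A) (hqs : ∀ x, q (-x) = q x)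
    (hqv : ∀ x, A / 2 ≤ x → q x = 0) (h₀ : 0 ≤ y) (h₁ : y < A) :
    q (smod y A) = q y + q (A - y) := by
  rcases lt_or_ge y (A / 2) with h | h
  · rw [smod_eq_self hA h₀ h, hqv (A - y) (by linarith), add_zero]
  · rw [smod_eq_sub hA h h₁, hqv y h, zero_add, ← hqs, neg_sub]

lemma sum_comp_smod_eq {q : ℝ → ℝ} {A h a : ℝ} {M : ℕ} (hA : 0 < A) (hMh : M * h = A)
    (hqs : ∀ x, q (-x) = q x) (hqv : ∀ x, A / 2 ≤ x → q x = 0)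
    (ha : a ∈ Set.Ico 0 h) :
    ∑ k ∈ Finset.range M, q (smod (a + k * h) A)
      = ∑ k ∈ Finset.range M, q (a + k * h) + ∑ k ∈ Finset.range M, q (h - a + k * h) := by
  have hh : 0 < h := ha.1.trans_lt ha.2
  rw [← Finset.sum_range_reflect (fun k : ℕ => q (h - a + k * h)), ← Finset.sum_add_distrib]
  refine Finset.sum_congr rfl fun k hk => ?_
  have hk' : k + 1 ≤ M := Finset.mem_range.mp hk
  have hkM : ((k : ℝ) + 1) * h ≤ M * h :=
    mul_le_mul_of_nonneg_right (by exact_mod_cast hk') hh.le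
  rw [comp_smod_eq_add hA hqs hqv (add_nonneg ha.1 (by positivity)) (by linarith [ha.2])]
  congr 2
  rw [show M - 1 - k = M - (k + 1) by omega, Nat.cast_sub hk', ← hMh]
  push_cast
  ring

/-- A left Riemann sum of an antitone function bounds its integral from above. -/
lemma integral_le_riemann_sum {q : ℝ → ℝ} (hqu : AntitoneOn q (Set.Ici 0)) {a h : ℝ}
    (ha : 0 ≤ a) (hh : 0 ≤ h) (M : ℕ) :
    ∫ x in a..a + h * M, q x ≤ h * ∑ k ∈ Finset.range M, q (a + k * h) := by
  have hg : AntitoneOn (fun t => q (a + h * t)) (Set.Icc (0 : ℝ) (0 + M)) :=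
    fun s hs t ht hst => hqu (add_nonneg ha (mul_nonneg hh hs.1))
      (add_nonneg ha (mul_nonneg hh ht.1)) (by gcongr)
  have := mul_le_mul_of_nonneg_left hg.integral_le_sum hh
  rw [intervalIntegral.mul_integral_comp_add_mul] at this
  simpa [mul_comm h] using this

/-- A left Riemann sum of an antitone function exceeds its integral by at most the first term. -/
lemma riemann_sum_le_add_integral {q : ℝ → ℝ} (hqu : AntitoneOn q (Set.Ici 0))
    (hq0 : ∀ x, 0 ≤ q x) {a h : ℝ} (ha : 0 ≤ a) (hh : 0 ≤ h) (M : ℕ) :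
    h * ∑ k ∈ Finset.range M, q (a + k * h) ≤ h * q a + ∫ x in a..a + h * M, q x := by
  have hg : AntitoneOn (fun t => q (a + h * t)) (Set.Icc (0 : ℝ) (0 + M)) :=
    fun s hs t ht hst => hqu (add_nonneg ha (mul_nonneg hh hs.1))
      (add_nonneg ha (mul_nonneg hh ht.1)) (by gcongr)
  have h₁ := mul_le_mul_of_nonneg_left hg.sum_le_integral hh
  rw [intervalIntegral.mul_integral_comp_add_mul] at h₁
  simp only [zero_add, mul_zero, add_zero, mul_comm h ((_ : ℕ) : ℝ)] at h₁
  have h₂ := Finset.sum_range_succ (fun k : ℕ => q (a + k * h)) M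
  rw [Finset.sum_range_succ'] at h₂
  simp only [Nat.cast_zero, zero_mul, add_zero] at h₂
  have h₃ := mul_nonneg hh (hq0 (a + M * h))
  have h₄ := congrArg (h * ·) h₂
  simp only [mul_add] at h₄
  rw [mul_comm h (M : ℝ)]
  linarith

lemma two_mul_integral_eq {q : ℝ → ℝ} {A R : ℝ} (hqs : ∀ x, q (-x) = q x)
    (hqv : ∀ x, A / 2 ≤ x → q x = 0) (hR : A / 2 ≤ R) (hR₀ : 0 ≤ R) :
    2 * ∫ x in (0 : ℝ)..R, q x = ∫ x, q x := by
  have h₁ : ∫ x, q x = ∫ x, q |x| := by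
    congr 1
    ext x
    rcases abs_choice x with h | h <;> rw [h]
    rw [hqs]
  rw [h₁, integral_comp_abs, intervalIntegral.integral_of_le hR₀]
  congr 1
  refine setIntegral_eq_of_subset_of_forall_sdiff_eq_zero measurableSet_Ioi
    Set.Ioc_subset_Ioi_self ?_ |>.symm
  rintro x ⟨hx, hx'⟩
  refine hqv x (hR.trans (le_of_not_ge fun h => hx' ⟨hx, h⟩))

lemma integral_mem_Icc {q : ℝ → ℝ} (hqu : AntitoneOn q (Set.Ici 0)) {a : ℝ} (ha : 0 ≤ a) :
    ∫ x in (0 : ℝ)..a, q x ∈ Set.Icc (a * q a) (a * q 0) := by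
  have hi : IntervalIntegrable q volume 0 a :=
    (hqu.mono (by rw [Set.uIcc_of_le ha]; exact Set.Icc_subset_Ici_self)).intervalIntegrable
  constructor
  · have := intervalIntegral.integral_mono_on ha (intervalIntegrable_const (c := q a)) hi
      fun x hx => hqu hx.1 ha hx.2
    simpa using this
  · have := intervalIntegral.integral_mono_on ha hi (intervalIntegrable_const (c := q 0))
      fun x hx => hqu Set.self_mem_Ici hx.1 hx.1
    simpa using this

/-- For a symmetric unimodal probability density `q` supported on `[-A/2, A/2)`,
the function `d(x) = Σ_{k=0}^{M-1} (A/M) q((x + k A/M) mod A)` satisfies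
`1 - (A/M) q(0) ≤ d(x) ≤ 1 + (A/M) q(0)` for all `x`. -/
theorem d_bounds
    (q : ℝ → ℝ) (A : ℝ) (hA : 0 < A)
    (hq0 : ∀ x : ℝ, 0 ≤ q x) (hqm : Measurable q)
    (hq1 : (∫ x : ℝ, q x) = 1)
    (hqs : ∀ x : ℝ, q (-x) = q x)
    (hqu : AntitoneOn q (Set.Ici (0 : ℝ)))
    (hqv : ∀ x : ℝ, x ∉ Set.Ico (-(A / 2)) (A / 2) → q x = 0)
    (M : ℕ) (hM : 1 ≤ M) :
    ∀ x : ℝ,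
      1 - (A / M) * q 0
          ≤ (∑ k ∈ Finset.range M, (A / M) * q (smod (x + (k : ℝ) * (A / M)) A))
      ∧ (∑ k ∈ Finset.range M, (A / M) * q (smod (x + (k : ℝ) * (A / M)) A))
          ≤ 1 + (A / M) * q 0 := by
  intro x
  have hM₀ : (0 : ℝ) < M := by exact_mod_cast hM
  have hv : ∀ x, A / 2 ≤ x → q x = 0 := fun x hx => hqv x fun h => h.2.not_ge hx
  rw [← Finset.mul_sum]
  have hMh : M * (A / M) = A := mul_div_cancel₀ A hM₀.ne'
  have hh : 0 < A / M := by positivity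
  set h := A / M
  have hper : Function.Periodic (fun y => q (smod y A)) (M * h) := by
    rw [hMh]
    exact (smod_periodic hA).comp q
  obtain ⟨a, ha, hxa⟩ := (sum_range_step_periodic hper).exists_mem_Ico₀ hh x
  rw [hxa, sum_comp_smod_eq hA hMh hqs hv ha, mul_add]
  have hi : ∀ u v : ℝ, 0 ≤ u → 0 ≤ v → IntervalIntegrable q volume u v := fun u v hu hv =>
    (hqu.mono fun y hy => (le_min hu hv).trans hy.1).intervalIntegrable
  have tail : ∀ c, 0 ≤ c → ∫ y in c..c + h * M, q y = 1 / 2 - ∫ y in (0 : ℝ)..c, q y := by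
    intro c hc
    have hR : 0 ≤ c + h * M := by positivity
    have h₁ := two_mul_integral_eq hqs hv (R := c + h * M) (by linarith) hR
    have h₂ := intervalIntegral.integral_add_adjacent_intervals (hi 0 c le_rfl hc)
      (hi c (c + h * M) hc hR)
    linarith
  have ha₀ := ha.1
  have hb₀ : 0 ≤ h - a := sub_nonneg.mpr ha.2.le
  have hIa := integral_mem_Icc hqu ha₀
  have hIb := integral_mem_Icc hqu hb₀
  have hta := tail a ha₀
  have htb := tail (h - a) hb₀
  constructor
  · have h₁ := integral_le_riemann_sum hqu ha₀ hh.le M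
    have h₂ := integral_le_riemann_sum hqu hb₀ hh.le M
    linarith [hIa.2, hIb.2]
  · have h₁ := riemann_sum_le_add_integral hqu hq0 ha₀ hh.le M
    have h₂ := riemann_sum_le_add_integral hqu hq0 hb₀ hh.le M
    have h₃ := mul_le_mul_of_nonneg_left (hqu Set.self_mem_Ici ha₀ ha₀) hb₀
    have h₄ := mul_le_mul_of_nonneg_left (hqu Set.self_mem_Ici hb₀ hb₀) ha₀
    linarith [hIa.1, hIb.1]
end

section
/- Let q : ℝ → ℝ be a probability density function that is symmetric (q(−x) = q(x)), unimodal (nonincreasing on [0, ∞)), and vanishes outside [−A/2, A/2), where A > 0. For each integer M ≥ 1 define d_M(x) = Σ_{k=0}^{M−1} (A/M) q( (x + k·A/M) mod A ). Then for every x ∈ ℝ, lim_{M→∞} d_M(x) = 1. -/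
open MeasureTheory

open Filter Topology in
/-- Left-endpoint Riemann sums of a bounded, a.e. continuous function on `[0, 1]` converge to its
integral. -/
theorem tendsto_riemannSum_of_ae_continuousAt {f : ℝ → ℝ} {C : ℝ} (hf : Measurable f)
    (hC : ∀ x, ‖f x‖ ≤ C) (hc : ∀ᵐ x, ContinuousAt f x) :
    Tendsto (fun M : ℕ => ∑ k ∈ Finset.range M, (1 / (M : ℝ)) * f (k / M)) atTop
      (𝓝 (∫ s in (0 : ℝ)..1, f s)) := by
  have hmeas : ∀ M : ℕ, Measurable fun s : ℝ => f (⌊s * M⌋₊ / M) := fun M => by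
    have : Measurable fun s : ℝ => (⌊s * M⌋₊ : ℝ) / M := by fun_prop
    exact hf.comp this
  have hint : ∀ (M : ℕ) (a b : ℝ),
      IntervalIntegrable (fun s : ℝ => f (⌊s * M⌋₊ / M)) volume a b := fun M a b =>
    (intervalIntegrable_const (c := C)).mono_fun (hmeas M).aestronglyMeasurable
      (Eventually.of_forall fun s => (hC _).trans (le_abs_self C))
  have key : Tendsto (fun M : ℕ => ∫ s in (0 : ℝ)..1, f (⌊s * M⌋₊ / M)) atTop
      (𝓝 (∫ s in (0 : ℝ)..1, f s)) := by
    refine intervalIntegral.tendsto_integral_filter_of_dominated_convergence (fun _ => C)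
      (Eventually.of_forall fun M => (hmeas M).aestronglyMeasurable)
      (Eventually.of_forall fun M => Eventually.of_forall fun s _ => hC _)
      intervalIntegrable_const ?_
    filter_upwards [hc] with s hs hs01
    rw [Set.uIoc_of_le zero_le_one] at hs01
    exact hs.tendsto.comp
      ((tendsto_nat_floor_mul_div_atTop hs01.1.le).comp tendsto_natCast_atTop_atTop)
  refine key.congr' ?_
  filter_upwards [eventually_gt_atTop 0] with M hM
  have hM' : (0 : ℝ) < M := by exact_mod_cast hM
  have hsum := intervalIntegral.sum_integral_adjacent_intervals (μ := volume)
    (f := fun s : ℝ => f (⌊s * M⌋₊ / M)) (a := fun k : ℕ => (k : ℝ) / M) (n := M)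
    fun k _ => hint M _ _
  simp only [Nat.cast_zero, zero_div, div_self hM'.ne'] at hsum
  rw [← hsum]
  refine Finset.sum_congr rfl fun k _ => ?_
  have hle : (k : ℝ) / M ≤ ((k + 1 : ℕ) : ℝ) / M := by gcongr; simp
  have hconst : ∫ s in (k : ℝ) / M..((k + 1 : ℕ) : ℝ) / M, f (⌊s * M⌋₊ / M)
      = ∫ _s in (k : ℝ) / M..((k + 1 : ℕ) : ℝ) / M, f (k / M) := by
    refine intervalIntegral.integral_congr_Ioo_of_le hle fun s hs => ?_
    have h1 := (div_lt_iff₀ hM').1 hs.1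
    have h2 := (lt_div_iff₀ hM').1 hs.2
    push_cast at h2
    have : ⌊s * M⌋₊ = k := (Nat.floor_eq_iff ((Nat.cast_nonneg k).trans h1.le)).2 ⟨h1.le, h2⟩
    simp [this]
  rw [hconst, intervalIntegral.integral_const, smul_eq_mul]
  congr 1
  push_cast
  ring

theorem abs_smod_eq_norm (x A : ℝ) : |smod x A| = ‖(x : AddCircle A)‖ := by
  rw [AddCircle.norm_eq, smod, div_eq_inv_mul, mul_comm A]

/-- The preimage of a countable set under the norm of the circle of length `A` is countable. -/
theorem countable_setOf_norm_addCircle_mem (A : ℝ) {D : Set ℝ} (hD : D.Countable) :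
    {t : ℝ | ‖(t : AddCircle A)‖ ∈ D}.Countable := by
  have hcount : (⋃ n : ℤ,
      ((fun d : ℝ => n * A + d) '' D ∪ (fun d : ℝ => n * A - d) '' D)).Countable :=
    Set.countable_iUnion fun n => (hD.image _).union (hD.image _)
  refine hcount.mono fun t ht => ?_
  rw [Set.mem_ofPred_eq, AddCircle.norm_eq] at ht
  refine Set.mem_iUnion.2 ⟨round (A⁻¹ * t), ?_⟩
  rcases abs_choice (t - round (A⁻¹ * t) * A) with h | h <;> rw [h] at ht
  · exact Or.inl ⟨_, ht, by ring⟩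
  · exact Or.inr ⟨_, ht, by ring⟩

/-- A function antitone on `[0, ∞)`, composed with the norm of a circle, is a.e. continuous. -/
theorem AntitoneOn.ae_continuousAt_comp_norm_addCircle {q : ℝ → ℝ}
    (hq : AntitoneOn q (Set.Ici 0)) (A : ℝ) :
    ∀ᵐ t : ℝ, ContinuousAt (fun t : ℝ => q ‖(t : AddCircle A)‖) t := by
  have hP : Antitone fun y : ℝ => q (max 0 y) := fun a b hab =>
    hq (Set.mem_Ici.2 (le_max_left _ _)) (Set.mem_Ici.2 (le_max_left _ _)) (max_le_max le_rfl hab)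
  have hcount := countable_setOf_norm_addCircle_mem A hP.countable_not_continuousAt
  have hae : ∀ᵐ t : ℝ, t ∉ {t : ℝ | ‖(t : AddCircle A)‖ ∈
      {y : ℝ | ¬ContinuousAt (fun y : ℝ => q (max 0 y)) y}} :=
    measure_eq_zero_iff_ae_notMem.1 (hcount.measure_zero volume)
  filter_upwards [hae] with t ht
  have hct : ContinuousAt (fun y : ℝ => q (max 0 y)) ‖(t : AddCircle A)‖ := not_not.1 ht
  have hn : Continuous fun t : ℝ => ‖(t : AddCircle A)‖ :=
    continuous_norm.comp (AddCircle.continuous_mk' A)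
  have h := ContinuousAt.comp (f := fun t : ℝ => ‖(t : AddCircle A)‖) hct hn.continuousAt
  simpa [Function.comp_def] using h

/-- For `q` even and vanishing outside `[-A/2, A/2)`, periodizing and integrating over one period
recovers `∫ q`. -/
theorem integral_comp_norm_addCircle {q : ℝ → ℝ} {A : ℝ} (hA : 0 < A)
    (hqs : ∀ x : ℝ, q (-x) = q x)
    (hqv : ∀ x : ℝ, x ∉ Set.Ico (-(A / 2)) (A / 2) → q x = 0) (x : ℝ) :
    ∫ t in x..x + A, q ‖(t : AddCircle A)‖ = ∫ t : ℝ, q t := by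
  have hper : Function.Periodic (fun t : ℝ => q ‖(t : AddCircle A)‖) A := fun t => by simp
  rw [hper.intervalIntegral_add_eq x (-(A / 2)), show -(A / 2) + A = A / 2 by ring,
    ← setIntegral_eq_integral_of_forall_compl_eq_zero hqv,
    intervalIntegral.integral_of_le (by linarith), ← integral_Ico_eq_integral_Ioc]
  refine setIntegral_congr_fun measurableSet_Ico fun t ht => ?_
  have hle : |t| ≤ |A| / 2 := by
    rw [abs_of_pos hA]
    exact abs_le.2 ⟨ht.1, ht.2.le⟩
  rw [(AddCircle.norm_coe_eq_abs_iff A hA.ne').2 hle]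
  rcases abs_choice t with h | h <;> rw [h]
  exact hqs t

/-- For a symmetric unimodal probability density `q` supported on `[-A/2, A/2)`,
the function `d_M(x) = Σ_{k=0}^{M-1} (A/M) q((x + k A/M) mod A)` tends to `1`
as `M → ∞`, for every `x`. -/
theorem d_tendsto_one
    (q : ℝ → ℝ) (A : ℝ) (hA : 0 < A)
    (hq0 : ∀ x : ℝ, 0 ≤ q x) (hqm : Measurable q)
    (hq1 : (∫ x : ℝ, q x) = 1)
    (hqs : ∀ x : ℝ, q (-x) = q x)
    (hqu : AntitoneOn q (Set.Ici (0 : ℝ)))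
    (hqv : ∀ x : ℝ, x ∉ Set.Ico (-(A / 2)) (A / 2) → q x = 0) :
    ∀ x : ℝ,
      Filter.Tendsto
        (fun M : ℕ =>
          ∑ k ∈ Finset.range M, (A / M) * q (smod (x + (k : ℝ) * (A / M)) A))
        Filter.atTop (nhds 1) := by
  intro x
  have hqabs : ∀ y : ℝ, q |y| = q y := fun y => by
    rcases abs_choice y with h | h <;> rw [h]
    exact hqs y
  set g : ℝ → ℝ := fun t => q ‖(t : AddCircle A)‖ with hg
  have hgm : Measurable g :=
    hqm.comp (continuous_norm.comp (AddCircle.continuous_mk' A)).measurable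
  have hline : Continuous fun s : ℝ => x + A * s := by fun_prop
  have hbound : ∀ s : ℝ, ‖A * g (x + A * s)‖ ≤ A * q 0 := fun s => by
    rw [Real.norm_of_nonneg (mul_nonneg hA.le (hq0 _))]
    exact mul_le_mul_of_nonneg_left
      (hqu Set.self_mem_Ici (norm_nonneg _) (norm_nonneg _)) hA.le
  have hqmp : Measure.QuasiMeasurePreserving (fun s : ℝ => x + A * s) volume volume := by
    refine (measurePreserving_add_left volume x).quasiMeasurePreserving.comp ⟨by fun_prop, ?_⟩
    rw [Real.map_volume_mul_left hA.ne']
    exact Measure.smul_absolutelyContinuous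
  have hcont : ∀ᵐ s : ℝ, ContinuousAt (fun s => A * g (x + A * s)) s := by
    filter_upwards [hqmp.ae (hqu.ae_continuousAt_comp_norm_addCircle A)] with s hs
    exact continuousAt_const.mul
      (ContinuousAt.comp (f := fun s : ℝ => x + A * s) hs hline.continuousAt)
  have hlim := tendsto_riemannSum_of_ae_continuousAt
    ((hgm.comp hline.measurable).const_mul A) hbound hcont
  have hint : ∫ s in (0 : ℝ)..1, A * g (x + A * s) = 1 := by
    rw [intervalIntegral.integral_const_mul, intervalIntegral.mul_integral_comp_add_mul]
    simp only [mul_zero, add_zero, mul_one]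
    rw [hg, integral_comp_norm_addCircle hA hqs hqv, hq1]
  rw [← hint]
  refine hlim.congr fun M => Finset.sum_congr rfl fun k _ => ?_
  rw [← hqabs (smod _ _), abs_smod_eq_norm, Function.comp_apply,
    show (k : ℝ) * (A / M) = A * (k / M) by ring]
  ring
end

section
/- Let q : ℝ → ℝ be a probability density function that is symmetric (q(−x) = q(x)), unimodal (nonincreasing on [0, ∞)), and vanishes outside [−A/2, A/2), where A > 0. Let M ≥ 1 be an integer, define d(x) = Σ_{k=0}^{M−1} (A/M) q( (x + k·A/M) mod A ), d_min = 1 − (A/M) q(0), and d_max = 1 + (A/M) q(0), and assume d_min > 0. Define p(x) = q(x)/d(x) for x ∈ [−A/2, A/2) and p(x) = 0 otherwise. Then for all x ∈ [−A/2, A/2), q(x)/d_max ≤ p(x) ≤ q(x)/d_min. -/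
open MeasureTheory

/-- Comparison of a unit-step Riemann sum on the half-line with the integral. -/
lemma AntitoneOn.half_line_sum_bounds {g : ℝ → ℝ} (hg : AntitoneOn g (Set.Ici 0)) {M : ℕ}
    (hv : ∀ t : ℝ, (M : ℝ) ≤ t → g t = 0) {u : ℝ} (hu0 : 0 ≤ u) (hu1 : u ≤ 1) :
    (∫ t in (0 : ℝ)..M, g t) - u * g 0 ≤ ∑ n ∈ Finset.range M, g (u + n) ∧
      ∑ n ∈ Finset.range M, g (u + n) ≤ (∫ t in (0 : ℝ)..M, g t) + (1 - u) * g 0 := by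
  have hM : (0 : ℝ) ≤ M := M.cast_nonneg
  have hint : ∀ a b : ℝ, 0 ≤ a → 0 ≤ b → IntervalIntegrable g volume a b := fun a b ha hb ↦
    (hg.mono fun t ht ↦ (le_min ha hb).trans ht.1).intervalIntegrable
  have hanti : AntitoneOn g (Set.Icc u (u + M)) := hg.mono fun t ht ↦ hu0.trans ht.1
  have hlow := hanti.integral_le_sum
  have hupp := hanti.sum_le_integral
  have htail : ∫ t in (M : ℝ)..(u + M), g t = 0 := by
    rw [intervalIntegral.integral_congr (g := fun _ ↦ (0 : ℝ)), intervalIntegral.integral_zero]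
    intro t ht
    rw [Set.uIcc_of_le (by linarith)] at ht
    exact hv t ht.1
  have hsplit : (∫ t in (0 : ℝ)..u, g t) + ∫ t in u..(u + M), g t = ∫ t in (0 : ℝ)..M, g t := by
    rw [intervalIntegral.integral_add_adjacent_intervals (hint _ _ le_rfl hu0)
        (hint _ _ hu0 (by linarith)),
      ← intervalIntegral.integral_add_adjacent_intervals (hint _ _ le_rfl hM)
        (hint _ _ hM (by linarith)), htail, add_zero]
  have hhead_le : ∫ t in (0 : ℝ)..u, g t ≤ u * g 0 := by
    have := intervalIntegral.integral_mono_on hu0 (hint _ _ le_rfl hu0)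
      (intervalIntegrable_const (c := g 0))
      fun t ht ↦ hg Set.self_mem_Ici ht.1 ht.1
    simpa using this
  have hle_head : u * g u ≤ ∫ t in (0 : ℝ)..u, g t := by
    have := intervalIntegral.integral_mono_on hu0 (intervalIntegrable_const (c := g u))
      (hint _ _ le_rfl hu0) fun t ht ↦ hg ht.1 hu0 ht.2
    simpa using this
  have hshift : ∑ n ∈ Finset.range M, g (u + n) ≤
      g u + ∑ n ∈ Finset.range M, g (u + (n + 1 : ℕ)) := by
    have h1 := Finset.sum_range_succ (fun n : ℕ ↦ g (u + n)) M
    have h2 := Finset.sum_range_succ' (fun n : ℕ ↦ g (u + n)) M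
    have h3 : g (u + M) = 0 := hv _ (by linarith)
    simp only [Nat.cast_zero, add_zero] at h2
    linarith
  have hgu : (1 - u) * g u ≤ (1 - u) * g 0 :=
    mul_le_mul_of_nonneg_left (hg Set.self_mem_Ici hu0 hu0) (by linarith)
  constructor <;> linarith

/-- The integral over the line of an even function vanishing beyond `M`. -/
lemma integral_eq_two_mul_of_even {g : ℝ → ℝ} (hs : ∀ t, g (-t) = g t) {M : ℝ} (hM : 0 ≤ M)
    (hv : ∀ t : ℝ, M ≤ t → g t = 0) : ∫ t, g t = 2 * ∫ t in (0 : ℝ)..M, g t := by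
  have habs : (fun t ↦ g |t|) = g := by
    funext t
    rcases abs_choice t with h | h <;> simp [h, hs]
  have h := integral_comp_abs (f := g)
  rw [habs] at h
  rw [h, intervalIntegral.integral_of_le hM]
  congr 1
  refine (setIntegral_eq_of_subset_of_forall_sdiff_eq_zero measurableSet_Ioi
    (fun t ht ↦ ht.1) fun t ht ↦ hv t ?_)
  by_contra! hlt
  exact ht.2 ⟨ht.1, hlt.le⟩

/-- The two-sided unit-step sum of an even unimodal function is within `g 0` of its integral. -/
lemma AntitoneOn.two_sided_sum_bounds {g : ℝ → ℝ} (hg : AntitoneOn g (Set.Ici 0))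
    (hs : ∀ t, g (-t) = g t) {M : ℕ} (hv : ∀ t : ℝ, (M : ℝ) ≤ t → g t = 0)
    {u : ℝ} (hu0 : 0 ≤ u) (hu1 : u ≤ 1) :
    (∫ t, g t) - g 0 ≤
        ∑ n ∈ Finset.range M, g (u + n) + ∑ n ∈ Finset.range M, g (1 - u + n) ∧
      ∑ n ∈ Finset.range M, g (u + n) + ∑ n ∈ Finset.range M, g (1 - u + n) ≤
        (∫ t, g t) + g 0 := by
  rw [integral_eq_two_mul_of_even hs M.cast_nonneg hv]
  have h1 := hg.half_line_sum_bounds hv hu0 hu1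
  have h2 := hg.half_line_sum_bounds hv (u := 1 - u) (by linarith) (by linarith)
  constructor <;> linarith [h1.1, h1.2, h2.1, h2.2]

lemma smod_add_int_mul {A : ℝ} (hA : A ≠ 0) (x : ℝ) (m : ℤ) : smod (x + m * A) A = smod x A := by
  have h : (x + m * A) / A = x / A + m := by field_simp
  rw [smod, smod, h, round_add_intCast]
  push_cast
  ring

lemma smod_eq_self_s8 {A x : ℝ} (hA : 0 < A) (hx : x ∈ Set.Ico (-(A / 2)) (A / 2)) :
    smod x A = x := by
  have h : round (x / A) = 0 := by
    rw [round_eq, Int.floor_eq_zero_iff]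
    have e : x / A + 1 / 2 = (x + A / 2) / A := by field_simp
    rw [e]
    exact ⟨div_nonneg (by linarith [hx.1]) hA.le, (div_lt_one hA).2 (by linarith [hx.2])⟩
  simp [smod, h]

/-- Sums of an `M`-periodic sequence over `M` consecutive integers do not depend on the start. -/
lemma Function.Periodic.sum_range_add_int {P : ℤ → ℝ} {M : ℕ} (hP : Function.Periodic P (M : ℤ))
    (m : ℤ) : ∑ k ∈ Finset.range M, P (m + k) = ∑ k ∈ Finset.range M, P k := by
  have step : ∀ m : ℤ,
      ∑ k ∈ Finset.range M, P (m + 1 + k) = ∑ k ∈ Finset.range M, P (m + k) := by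
    intro m
    have h1 := Finset.sum_range_succ (fun k : ℕ ↦ P (m + k)) M
    have h2 := Finset.sum_range_succ' (fun k : ℕ ↦ P (m + k)) M
    have h3 : ∀ k : ℕ, P (m + (k + 1 : ℕ)) = P (m + 1 + k) := fun k ↦ by
      congr 1
      push_cast
      ring
    simp only [h3, hP m, Nat.cast_zero, add_zero] at h1 h2
    linarith
  induction m using Int.induction_on with
  | zero => simp
  | succ i ih => rw [step, ih]
  | pred i ih => rw [← step, sub_add_cancel, ih]

/-- On a single period `[0, A)`, a function supported in `[-A/2, A/2)` periodizes to two terms. -/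
lemma apply_smod_eq_add {q : ℝ → ℝ} {A : ℝ} (hA : 0 < A)
    (hqv : ∀ x : ℝ, x ∉ Set.Ico (-(A / 2)) (A / 2) → q x = 0) {z : ℝ} (hz0 : 0 ≤ z)
    (hzA : z < A) : q (smod z A) = q z + q (z - A) := by
  rcases lt_or_ge z (A / 2) with h | h
  · rw [smod_eq_self_s8 hA ⟨by linarith, h⟩, hqv (z - A) fun hm ↦ by linarith [hm.1], add_zero]
  · have e : smod z A = z - A := by
      have := smod_add_int_mul hA.ne' (z - A) 1
      rw [Int.cast_one, one_mul, sub_add_cancel] at this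
      rw [this, smod_eq_self_s8 hA ⟨by linarith, by linarith⟩]
    rw [e, hqv z fun hm ↦ by linarith [hm.2], zero_add]

/-- The periodized sum as a sum over the two half-lines. -/
lemma sum_apply_smod {q : ℝ → ℝ} {A : ℝ} (hA : 0 < A) (hqs : ∀ x : ℝ, q (-x) = q x)
    (hqv : ∀ x : ℝ, x ∉ Set.Ico (-(A / 2)) (A / 2) → q x = 0) {M : ℕ} (hM : 1 ≤ M) (x : ℝ) :
    ∑ k ∈ Finset.range M, q (smod (x + (k : ℝ) * (A / M)) A) =
      ∑ n ∈ Finset.range M, q (A / M * (Int.fract (x / (A / M)) + n)) +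
        ∑ n ∈ Finset.range M, q (A / M * (1 - Int.fract (x / (A / M)) + n)) := by
  have hM0 : (0 : ℝ) < M := by exact_mod_cast hM
  set h : ℝ := A / M with hh
  have hpos : 0 < h := div_pos hA hM0
  have hMh : A = M * h := by rw [hh]; field_simp
  set u : ℝ := Int.fract (x / h) with hu
  have hu0 : 0 ≤ u := Int.fract_nonneg _
  have hu1 : u < 1 := Int.fract_lt_one _
  have hx : x = h * (u + ⌊x / h⌋) := by
    rw [hu, Int.fract_add_floor]
    field_simp
  have hP : Function.Periodic (fun n : ℤ ↦ q (smod (h * (u + n)) A)) (M : ℤ) := by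
    intro n
    have e : h * (u + ((n + (M : ℤ) : ℤ) : ℝ)) = h * (u + n) + (1 : ℤ) * A := by
      push_cast
      rw [hMh]
      ring
    simp only [e, smod_add_int_mul hA.ne']
  have hshift := hP.sum_range_add_int ⌊x / h⌋
  have e1 : ∑ k ∈ Finset.range M, q (smod (x + (k : ℝ) * h) A) =
      ∑ k ∈ Finset.range M, q (smod (h * (u + k)) A) := by
    refine Eq.trans (Finset.sum_congr rfl fun k _ ↦ ?_) (hshift.trans (by simp))
    congr 2
    conv_lhs => rw [hx]
    push_cast
    ring
  rw [e1, ← Finset.sum_range_reflect (fun n : ℕ ↦ q (h * (1 - u + n))), ← Finset.sum_add_distrib]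
  refine Finset.sum_congr rfl fun k hk ↦ ?_
  have hkM : k + 1 ≤ M := Finset.mem_range.1 hk
  have hkM' : (k : ℝ) + 1 ≤ M := by exact_mod_cast hkM
  have hk0 : (0 : ℝ) ≤ k := k.cast_nonneg
  rw [apply_smod_eq_add hA hqv (by positivity)
    (by rw [hMh, mul_comm (M : ℝ)]; exact mul_lt_mul_of_pos_left (by linarith) hpos), ← hqs (_ - A)]
  congr 2
  rw [Nat.sub_sub, Nat.cast_sub (by omega), hMh]
  push_cast
  ring

/-- Bounds (11) of the paper: with `d(x) = Σ_{k=0}^{M-1} (A/M) q((x + k A/M) mod A)`,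
`d_min = 1 - (A/M) q(0)`, `d_max = 1 + (A/M) q(0)`, `d_min > 0`, and
`p(x) = q(x)/d(x)` on `[-A/2, A/2)` (and `0` elsewhere), one has
`q(x)/d_max ≤ p(x) ≤ q(x)/d_min` for all `x ∈ [-A/2, A/2)`. -/
theorem p_bounds
    (q : ℝ → ℝ) (A : ℝ) (hA : 0 < A)
    (hq0 : ∀ x : ℝ, 0 ≤ q x) (hqm : Measurable q)
    (hq1 : (∫ x : ℝ, q x) = 1)
    (hqs : ∀ x : ℝ, q (-x) = q x)
    (hqu : AntitoneOn q (Set.Ici (0 : ℝ)))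
    (hqv : ∀ x : ℝ, x ∉ Set.Ico (-(A / 2)) (A / 2) → q x = 0)
    (M : ℕ) (hM : 1 ≤ M)
    (d : ℝ → ℝ)
    (hd : ∀ x : ℝ,
      d x = ∑ k ∈ Finset.range M, (A / M) * q (smod (x + (k : ℝ) * (A / M)) A))
    (hdmin : 0 < 1 - (A / M) * q 0)
    (p : ℝ → ℝ)
    (hp : ∀ x : ℝ, p x = if x ∈ Set.Ico (-(A / 2)) (A / 2) then q x / d x else 0) :
    ∀ x ∈ Set.Ico (-(A / 2)) (A / 2),
      q x / (1 + (A / M) * q 0) ≤ p x ∧ p x ≤ q x / (1 - (A / M) * q 0) := by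
  intro x hx
  have hM0 : (0 : ℝ) < M := by exact_mod_cast hM
  have hpos : 0 < A / M := div_pos hA hM0
  have hbounds := AntitoneOn.two_sided_sum_bounds (g := fun t ↦ q (A / M * t)) (M := M)
    (fun s hs t ht hst ↦ hqu (mul_nonneg hpos.le hs) (mul_nonneg hpos.le ht)
      (mul_le_mul_of_nonneg_left hst hpos.le))
    (fun t ↦ by simp only [mul_neg, hqs])
    (fun t ht ↦ hqv _ fun hm ↦ by
      have h1 : A / M * M ≤ A / M * t := mul_le_mul_of_nonneg_left ht hpos.le
      rw [div_mul_cancel₀ _ hM0.ne'] at h1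
      linarith [hm.2])
    (Int.fract_nonneg (x / (A / M))) (Int.fract_lt_one _).le
  have hint : A / M * ∫ t, q (A / M * t) = 1 := by
    rw [Measure.integral_comp_mul_left, hq1, abs_of_pos (inv_pos.2 hpos), smul_eq_mul, mul_one,
      mul_inv_cancel₀ hpos.ne']
  rw [← sum_apply_smod hA hqs hqv hM x, mul_zero] at hbounds
  have hdx := hd x
  rw [← Finset.mul_sum] at hdx
  have hlow := mul_le_mul_of_nonneg_left hbounds.1 hpos.le
  have hupp := mul_le_mul_of_nonneg_left hbounds.2 hpos.le
  rw [mul_sub, hint, ← hdx] at hlow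
  rw [mul_add, hint, ← hdx] at hupp
  rw [hp x, if_pos hx]
  exact ⟨div_le_div_of_nonneg_left (hq0 x) (hdmin.trans_le hlow) hupp,
    div_le_div_of_nonneg_left (hq0 x) hdmin hlow⟩
end

section
/- Let q : ℝ → ℝ be a probability density function that is symmetric (q(−x) = q(x)) and unimodal (nonincreasing on [0, ∞)), and suppose q·log q is Lebesgue integrable. Let p : ℝ → ℝ be a probability density function and let 0 < d_min ≤ d_max be reals such that q(x)/d_max ≤ p(x) ≤ q(x)/d_min for all x ∈ ℝ. Let h(p) = ∫_ℝ −p(x) log p(x) dx and h_q = ∫_ℝ −q(x) log q(x) dx (natural logarithm). Then h(p) ≥ h_q/d_max + log d_min − (1/d_min − 1/d_max)·max(q(0) log q(0), 0). -/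
open MeasureTheory

/-- A function that is even and nonincreasing on `[0, ∞)` is bounded by its value at `0`. -/
theorem le_apply_zero_of_even_of_antitoneOn {q : ℝ → ℝ} (hqs : ∀ x, q (-x) = q x)
    (hqu : AntitoneOn q (Set.Ici 0)) (x : ℝ) : q x ≤ q 0 := by
  rcases le_total 0 x with h | h
  · exact hqu Set.self_mem_Ici h h
  · rw [← hqs x]
    exact hqu Set.self_mem_Ici (neg_nonneg.mpr h) (neg_nonneg.mpr h)

/-- If `p` lies between two positive multiples of `q`, then `p log p` is controlled by
`q log q` and `p`. -/
theorem abs_mul_log_le_of_between {p q a b : ℝ} (ha : 0 < a) (hab : a ≤ b) (hq : 0 ≤ q)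
    (hp : 0 ≤ p) (hlb : q / b ≤ p) (hub : p ≤ q / a) :
    |p * Real.log p| ≤ 1 / a * |q * Real.log q| + (|Real.log a| + |Real.log b|) * p := by
  have hb : 0 < b := ha.trans_le hab
  rcases hq.eq_or_lt with rfl | hq
  · have : p = 0 := le_antisymm (by simpa using hub) hp
    simp [this]
  have hp' : 0 < p := (div_pos hq hb).trans_le hlb
  have h1 := Real.log_le_log (div_pos hq hb) hlb
  have h2 := Real.log_le_log hp' hub
  rw [Real.log_div hq.ne' hb.ne'] at h1
  rw [Real.log_div hq.ne' ha.ne'] at h2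
  have h3 : |Real.log p| ≤ |Real.log q| + (|Real.log a| + |Real.log b|) := by
    rw [abs_le]
    constructor <;> linarith [neg_abs_le (Real.log q), le_abs_self (Real.log q),
      neg_abs_le (Real.log a), abs_nonneg (Real.log a), le_abs_self (Real.log b),
      abs_nonneg (Real.log b)]
  have h4 : p * |Real.log q| ≤ q / a * |Real.log q| :=
    mul_le_mul_of_nonneg_right hub (abs_nonneg _)
  rw [abs_mul, abs_mul, abs_of_pos hp', abs_of_pos hq]
  calc p * |Real.log p| ≤ p * (|Real.log q| + (|Real.log a| + |Real.log b|)) := by gcongr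
    _ = p * |Real.log q| + (|Real.log a| + |Real.log b|) * p := by ring
    _ ≤ q / a * |Real.log q| + (|Real.log a| + |Real.log b|) * p := by gcongr
    _ = _ := by ring

/-- Pointwise upper bound on `p log p` when `q / b ≤ p ≤ q / a` and `log q ≤ M`. -/
theorem mul_log_le_of_between {p q a b M : ℝ} (ha : 0 < a) (hq : 0 ≤ q)
    (hp : 0 ≤ p) (hlb : q / b ≤ p) (hub : p ≤ q / a) (hM : Real.log q ≤ M) :
    p * Real.log p ≤ 1 / b * (q * Real.log q) - Real.log a * p + M * (p - 1 / b * q) := by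
  have h1 : p * Real.log p ≤ p * Real.log q - Real.log a * p := by
    rcases hp.eq_or_lt with rfl | hp
    · simp
    have hq' : 0 < q := by
      rcases hq.eq_or_lt with rfl | h
      · simp only [zero_div] at hub
        linarith
      · exact h
    have h2 := Real.log_le_log hp hub
    rw [Real.log_div hq'.ne' ha.ne'] at h2
    nlinarith [mul_le_mul_of_nonneg_left h2 hp.le]
  have h3 : 0 ≤ p - 1 / b * q := by
    have : 1 / b * q = q / b := by ring
    linarith
  nlinarith [mul_le_mul_of_nonneg_left hM h3]

/-- Differential entropy lower bound (15) of the paper: if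
`q(x)/d_max ≤ p(x) ≤ q(x)/d_min` for a symmetric unimodal density `q` with
`q log q` integrable, then
`h(p) ≥ h_q/d_max + log d_min − (1/d_min − 1/d_max) [q(0) log q(0)]⁺`. -/
theorem entropy_lower_bound
    (q : ℝ → ℝ) (hq0 : ∀ x : ℝ, 0 ≤ q x) (hqm : Measurable q)
    (hq1 : (∫ x : ℝ, q x) = 1)
    (hqs : ∀ x : ℝ, q (-x) = q x)
    (hqu : AntitoneOn q (Set.Ici (0 : ℝ)))
    (hqlog : Integrable (fun x : ℝ => q x * Real.log (q x)))
    (p : ℝ → ℝ) (hp0 : ∀ x : ℝ, 0 ≤ p x) (hpm : Measurable p)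
    (hp1 : (∫ x : ℝ, p x) = 1)
    (dmin dmax : ℝ) (hdmin : 0 < dmin) (hdd : dmin ≤ dmax)
    (hlb : ∀ x : ℝ, q x / dmax ≤ p x) (hub : ∀ x : ℝ, p x ≤ q x / dmin) :
    (∫ x : ℝ, -(p x * Real.log (p x)))
      ≥ (∫ x : ℝ, -(q x * Real.log (q x))) / dmax + Real.log dmin
          - (1 / dmin - 1 / dmax) * max (q 0 * Real.log (q 0)) 0 := by
  have hdmax : 0 < dmax := hdmin.trans_le hdd
  have hqi : Integrable q := by
    by_contra h
    simp [integral_undef h] at hq1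
  have hpi : Integrable p := by
    by_contra h
    simp [integral_undef h] at hp1
  have hpl : Integrable (fun x => p x * Real.log (p x)) := by
    refine ((hqlog.abs.const_mul (1 / dmin)).add
      (hpi.const_mul (|Real.log dmin| + |Real.log dmax|))).mono'
      (hpm.mul hpm.log).aestronglyMeasurable (Filter.Eventually.of_forall fun x => ?_)
    exact abs_mul_log_le_of_between hdmin hdd (hq0 x) (hp0 x) (hlb x) (hub x)
  set M := max (Real.log (q 0)) 0 with hMdef
  have hM0 : 0 ≤ M := le_max_right _ _
  have hM : ∀ x, Real.log (q x) ≤ M := fun x => by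
    rcases (hq0 x).eq_or_lt with h | h
    · simpa [← h] using hM0
    · exact (Real.log_le_log h (le_apply_zero_of_even_of_antitoneOn hqs hqu x)).trans
        (le_max_left _ _)
  have hr : Integrable (fun x => M * (p x - 1 / dmax * q x)) :=
    (hpi.sub (hqi.const_mul _)).const_mul _
  have hs : Integrable (fun x => 1 / dmax * (q x * Real.log (q x)) - Real.log dmin * p x) :=
    (hqlog.const_mul _).sub (hpi.const_mul _)
  have key := integral_mono hpl (hs.add hr) fun x =>
    mul_log_le_of_between hdmin (hq0 x) (hp0 x) (hlb x) (hub x) (hM x)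
  simp only [Pi.add_apply] at key
  rw [integral_add hs hr, integral_sub (hqlog.const_mul _) (hpi.const_mul _),
    integral_const_mul, integral_const_mul, integral_const_mul,
    integral_sub hpi (hqi.const_mul _), integral_const_mul, hp1, hq1] at key
  have hmin : 1 ≤ 1 / dmin := by
    have := integral_mono hpi (hqi.div_const dmin) hub
    rwa [integral_div, hp1, hq1] at this
  have hmax : 1 / dmax ≤ 1 := by
    have := integral_mono (hqi.div_const dmax) hpi hlb
    rwa [integral_div, hp1, hq1] at this
  have hMq : M ≤ max (q 0 * Real.log (q 0)) 0 := by
    refine max_le ?_ (le_max_right _ _)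
    rcases le_total (q 0) 1 with h | h
    · exact (Real.log_nonpos (hq0 0) h).trans (le_max_right _ _)
    · exact (le_mul_of_one_le_left (Real.log_nonneg h) h).trans (le_max_left _ _)
  have hfin : M * (1 - 1 / dmax) ≤
      (1 / dmin - 1 / dmax) * max (q 0 * Real.log (q 0)) 0 := by
    rw [mul_comm]
    exact mul_le_mul (by linarith) hMq hM0 (by linarith)
  rw [integral_neg, integral_neg, ge_iff_le, neg_div, div_eq_mul_one_div, mul_comm (∫ x, _)]
  linarith
end

section
/- Let q : ℝ → ℝ be a probability density function that is symmetric (q(−x) = q(x)) and unimodal (nonincreasing on [0, ∞)), and suppose q·log q is Lebesgue integrable. Let p : ℝ → ℝ be a probability density function and let 0 < d_min ≤ d_max be reals such that q(x)/d_max ≤ p(x) ≤ q(x)/d_min for all x ∈ ℝ. Let h(p) = ∫_ℝ −p(x) log p(x) dx and h_q = ∫_ℝ −q(x) log q(x) dx (natural logarithm). Then h(p) ≤ h_q/d_min + log d_max + (1/d_min − 1/d_max)·max(q(0) log q(0), 0). -/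
open MeasureTheory

/-- The logarithm of a number squeezed between `b / dmax` and `b / dmin`. -/
lemma log_bounds_of_div_le_of_le_div {a b dmin dmax : ℝ} (hb : 0 < b) (hdmin : 0 < dmin)
    (hdmax : 0 < dmax) (hlb : b / dmax ≤ a) (hub : a ≤ b / dmin) :
    Real.log b - Real.log dmax ≤ Real.log a ∧ Real.log a ≤ Real.log b - Real.log dmin := by
  have ha : 0 < a := (div_pos hb hdmax).trans_le hlb
  rw [← Real.log_div hb.ne' hdmax.ne', ← Real.log_div hb.ne' hdmin.ne']
  exact ⟨Real.log_le_log (div_pos hb hdmax) hlb, Real.log_le_log ha hub⟩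

lemma abs_mul_log_le_of_div_le_of_le_div {a b dmin dmax : ℝ} (ha : 0 ≤ a) (hb : 0 ≤ b)
    (hdmin : 0 < dmin) (hdmax : 0 < dmax) (hlb : b / dmax ≤ a) (hub : a ≤ b / dmin) :
    |a * Real.log a| ≤
      |b * Real.log b| / dmin + a * (|Real.log dmin| + |Real.log dmax|) := by
  rcases hb.eq_or_lt with rfl | hb
  · have : a = 0 := le_antisymm (by simpa using hub) ha
    simp [this]
  obtain ⟨h₁, h₂⟩ := log_bounds_of_div_le_of_le_div hb hdmin hdmax hlb hub
  have hlog : |Real.log a| ≤ |Real.log b| + (|Real.log dmin| + |Real.log dmax|) := by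
    rw [abs_le]
    constructor <;>
      linarith [neg_abs_le (Real.log b), le_abs_self (Real.log b), le_abs_self (Real.log dmax),
        neg_abs_le (Real.log dmin), abs_nonneg (Real.log dmin), abs_nonneg (Real.log dmax)]
  calc |a * Real.log a| = a * |Real.log a| := by rw [abs_mul, abs_of_nonneg ha]
    _ ≤ a * (|Real.log b| + (|Real.log dmin| + |Real.log dmax|)) := by gcongr
    _ = a * |Real.log b| + a * (|Real.log dmin| + |Real.log dmax|) := by ring
    _ ≤ b / dmin * |Real.log b| + a * (|Real.log dmin| + |Real.log dmax|) := by gcongr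
    _ = |b * Real.log b| / dmin + a * (|Real.log dmin| + |Real.log dmax|) := by
      rw [abs_mul, abs_of_pos hb]; ring

lemma neg_mul_log_le_of_div_le_of_le_div {a b c dmin dmax : ℝ} (ha : 0 ≤ a) (hb : 0 ≤ b)
    (hbc : b ≤ c) (hdmin : 0 < dmin) (hdd : dmin ≤ dmax)
    (hlb : b / dmax ≤ a) (hub : a ≤ b / dmin) :
    -(a * Real.log a) ≤ -(b * Real.log b) / dmin + a * Real.log dmax +
      b * ((1 / dmin - 1 / dmax) * max (Real.log c) 0) := by
  have hdmax : 0 < dmax := hdmin.trans_le hdd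
  rcases hb.eq_or_lt with rfl | hb
  · have : a = 0 := le_antisymm (by simpa using hub) ha
    simp [this]
  obtain ⟨h₁, -⟩ := log_bounds_of_div_le_of_le_div hb hdmin hdmax hlb hub
  have hd : 0 ≤ 1 / dmin - 1 / dmax := sub_nonneg.2 (one_div_le_one_div_of_le hdmin hdd)
  have hkey : (b / dmin - a) * Real.log b ≤
      b * ((1 / dmin - 1 / dmax) * max (Real.log c) 0) := by
    calc (b / dmin - a) * Real.log b ≤ (b / dmin - a) * max (Real.log c) 0 := by
          refine mul_le_mul_of_nonneg_left ?_ (sub_nonneg.2 hub)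
          exact (Real.log_le_log hb hbc).trans (le_max_left _ _)
      _ ≤ (b / dmin - b / dmax) * max (Real.log c) 0 := by gcongr
      _ = b * ((1 / dmin - 1 / dmax) * max (Real.log c) 0) := by ring
  have h := mul_le_mul_of_nonneg_left h₁ ha
  have : -(b * Real.log b) / dmin = -(b / dmin * Real.log b) := by ring
  rw [this]
  linarith

lemma max_log_zero_le_max_mul_log_zero {c : ℝ} (hc : 0 ≤ c) :
    max (Real.log c) 0 ≤ max (c * Real.log c) 0 := by
  rcases le_total c 1 with h | h
  · rw [max_eq_right (Real.log_nonpos hc h)]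
    exact le_max_right _ _
  · exact max_le_max_right _ (le_mul_of_one_le_left (Real.log_nonneg h) h)

/-- Differential entropy upper bound (16) of the paper: if
`q(x)/d_max ≤ p(x) ≤ q(x)/d_min` for a symmetric unimodal density `q` with
`q log q` integrable, then
`h(p) ≤ h_q/d_min + log d_max + (1/d_min − 1/d_max) [q(0) log q(0)]⁺`. -/
theorem entropy_upper_bound
    (q : ℝ → ℝ) (hq0 : ∀ x : ℝ, 0 ≤ q x) (hqm : Measurable q)
    (hq1 : (∫ x : ℝ, q x) = 1)
    (hqs : ∀ x : ℝ, q (-x) = q x)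
    (hqu : AntitoneOn q (Set.Ici (0 : ℝ)))
    (hqlog : Integrable (fun x : ℝ => q x * Real.log (q x)))
    (p : ℝ → ℝ) (hp0 : ∀ x : ℝ, 0 ≤ p x) (hpm : Measurable p)
    (hp1 : (∫ x : ℝ, p x) = 1)
    (dmin dmax : ℝ) (hdmin : 0 < dmin) (hdd : dmin ≤ dmax)
    (hlb : ∀ x : ℝ, q x / dmax ≤ p x) (hub : ∀ x : ℝ, p x ≤ q x / dmin) :
    (∫ x : ℝ, -(p x * Real.log (p x)))
      ≤ (∫ x : ℝ, -(q x * Real.log (q x))) / dmin + Real.log dmax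
          + (1 / dmin - 1 / dmax) * max (q 0 * Real.log (q 0)) 0 := by
  have hdmax : 0 < dmax := hdmin.trans_le hdd
  have hd : 0 ≤ 1 / dmin - 1 / dmax := sub_nonneg.2 (one_div_le_one_div_of_le hdmin hdd)
  have hqi : Integrable q := integrable_of_integral_eq_one hq1
  have hpi : Integrable p := integrable_of_integral_eq_one hp1
  have hqle : ∀ x, q x ≤ q 0 := by
    intro x
    rcases le_total 0 x with h | h
    · exact hqu Set.self_mem_Ici h h
    · rw [← hqs x]
      exact hqu Set.self_mem_Ici (neg_nonneg.2 h) (neg_nonneg.2 h)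
  have hplog : Integrable (fun x => p x * Real.log (p x)) := by
    refine ((hqlog.abs.div_const dmin).add
      (hpi.mul_const (|Real.log dmin| + |Real.log dmax|))).mono'
      (hpm.mul (Real.measurable_log.comp hpm)).aestronglyMeasurable (.of_forall fun x => ?_)
    exact abs_mul_log_le_of_div_le_of_le_div (hp0 x) (hq0 x) hdmin hdmax (hlb x) (hub x)
  have hi₁ : Integrable (fun x => -(q x * Real.log (q x)) / dmin) := hqlog.neg.div_const dmin
  have hi₂ : Integrable (fun x => p x * Real.log dmax) := hpi.mul_const _
  have hi₃ : Integrable (fun x => q x * ((1 / dmin - 1 / dmax) * max (Real.log (q 0)) 0)) :=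
    hqi.mul_const _
  have hi₁₂ : Integrable (fun x => -(q x * Real.log (q x)) / dmin + p x * Real.log dmax) :=
    hi₁.add hi₂
  calc (∫ x, -(p x * Real.log (p x)))
      ≤ ∫ x, (-(q x * Real.log (q x)) / dmin + p x * Real.log dmax +
          q x * ((1 / dmin - 1 / dmax) * max (Real.log (q 0)) 0)) :=
        integral_mono hplog.neg (hi₁₂.add hi₃) fun x =>
          neg_mul_log_le_of_div_le_of_le_div (hp0 x) (hq0 x) (hqle x) hdmin hdd (hlb x) (hub x)
    _ = (∫ x, -(q x * Real.log (q x))) / dmin + Real.log dmax +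
          (1 / dmin - 1 / dmax) * max (Real.log (q 0)) 0 := by
        rw [integral_add hi₁₂ hi₃, integral_add hi₁ hi₂, integral_div, integral_mul_const,
          integral_mul_const, hp1, hq1, one_mul, one_mul]
    _ ≤ _ := by
        have h := max_log_zero_le_max_mul_log_zero (hq0 0)
        gcongr _ + _ * ?_
end

section
/- Let f : ℝ → ℝ be a probability density function that is symmetric (f(−x) = f(x)) and unimodal (nonincreasing on [0, ∞)). Let A > 0 be real and M ≥ 1 an integer, and define F(y) = (1/M) Σ_{k∈ℤ} f( y + k·A/M + A/(2M) ) for y ∈ ℝ. Then for every y ∈ ℝ, | F(y) − 1/A | ≤ f(0)/M; in particular (1/A)(1 − (A/M) f(0)) ≤ F(y) ≤ (1/A)(1 + (A/M) f(0)). -/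
open MeasureTheory Set

/-- Comparison of `h ∑ f (a + n h)` with the integral of `f` over `(0, ∞)`, for `f` antitone. -/
theorem riemann_sum_bounds_of_antitoneOn {f : ℝ → ℝ} (hf0 : ∀ x, 0 ≤ f x) (hfi : Integrable f)
    (hfu : AntitoneOn f (Ici 0)) {a h : ℝ} (ha : 0 ≤ a) (hh : 0 < h) :
    Summable (fun n : ℕ => f (a + h * n)) ∧
      (∫ x in Ioi 0, f x) - a * f 0 ≤ h * ∑' n : ℕ, f (a + h * n) ∧
      h * ∑' n : ℕ, f (a + h * n) ≤ (∫ x in Ioi 0, f x) - a * f a + h * f a := by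
  have hga : AntitoneOn (fun x => f (a + h * x)) (Ici 0) := by
    intro x hx y hy hxy
    have hx' : 0 ≤ x := hx
    have hy' : 0 ≤ y := hy
    exact hfu (mem_Ici.2 (by positivity)) (mem_Ici.2 (by positivity)) (by gcongr)
  have hgi : IntegrableOn (fun x => f (a + h * x)) (Ioi 0) :=
    ((hfi.comp_add_left a).comp_mul_left' hh.ne').integrableOn
  have hg0 : ∀ t ∈ Ioi (0 : ℝ), 0 ≤ f (a + h * t) := fun t _ => hf0 _
  have hsum := hga.summable_of_integrableOn_Ioi_zero hgi hg0
  have hlow := hga.integral_le_tsum hsum hg0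
  have hupp := hga.tsum_le_integral hgi hg0
  have hscale : h * ∫ x in Ioi 0, f (a + h * x) = ∫ x in Ioi a, f x := by
    have h1 := integral_comp_mul_left_Ioi' (fun u => f (a + u)) 0 hh
    have h2 := (measurePreserving_add_left volume a).setIntegral_preimage_emb
      (measurableEmbedding_addLeft a) f (Ioi a)
    simp only [mul_zero, smul_eq_mul] at h1
    simp only [preimage_const_add_Ioi, sub_self] at h2
    rw [h1, h2]
  have hsplit := intervalIntegral.integral_interval_add_Ioi (a := 0) (b := a)
    hfi.integrableOn hfi.integrableOn
  have hle : ∫ x in (0 : ℝ)..a, f x ≤ a * f 0 := by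
    have := intervalIntegral.integral_mono_on ha hfi.intervalIntegrable
      (intervalIntegrable_const (c := f 0))
      fun x hx => hfu (mem_Ici.2 le_rfl) (mem_Ici.2 hx.1) hx.1
    simpa using this
  have hge : a * f a ≤ ∫ x in (0 : ℝ)..a, f x := by
    have := intervalIntegral.integral_mono_on ha (intervalIntegrable_const (c := f a))
      hfi.intervalIntegrable
      fun x hx => hfu (mem_Ici.2 hx.1) (mem_Ici.2 ha) hx.2
    simpa using this
  have hlow' := mul_le_mul_of_nonneg_left hlow hh.le
  have hupp' := mul_le_mul_of_nonneg_left hupp hh.le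
  simp only [mul_zero, add_zero, mul_add] at hupp'
  refine ⟨hsum, ?_, ?_⟩ <;> linarith

/-- The Riemann sum over `c + hℤ` of a symmetric unimodal function differs from its integral by at
most `h * f 0`. -/
theorem abs_riemann_sum_sub_integral_le {f : ℝ → ℝ} (hf0 : ∀ x, 0 ≤ f x) (hfi : Integrable f)
    (hfs : ∀ x, f (-x) = f x) (hfu : AntitoneOn f (Ici 0)) (c : ℝ) {h : ℝ} (hh : 0 < h) :
    |h * ∑' k : ℤ, f (c + k * h) - ∫ x, f x| ≤ h * f 0 := by
  set m : ℤ := ⌊c / h⌋ with hm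
  obtain ⟨a, ha⟩ : ∃ a, a = c - m * h := ⟨_, rfl⟩
  have ha0 : 0 ≤ a := by
    have := (le_div_iff₀ hh).1 (Int.floor_le (c / h))
    linarith
  have hb0 : 0 ≤ h - a := by
    have := (div_lt_iff₀ hh).1 (Int.lt_floor_add_one (c / h))
    linarith
  obtain ⟨hs1, hl1, hu1⟩ := riemann_sum_bounds_of_antitoneOn hf0 hfi hfu ha0 hh
  obtain ⟨hs2, hl2, hu2⟩ := riemann_sum_bounds_of_antitoneOn hf0 hfi hfu hb0 hh
  have hshift : ∑' k : ℤ, f (c + k * h) = ∑' k : ℤ, f (a + h * k) := by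
    rw [← (Equiv.addRight m).tsum_eq fun k : ℤ => f (a + h * k)]
    refine tsum_congr fun k => congrArg f ?_
    rw [Equiv.coe_addRight, ha]
    push_cast
    ring
  have hneg : (fun n : ℕ => f (a + h * ((-(n + 1 : ℤ) : ℤ) : ℝ))) =
      fun n : ℕ => f (h - a + h * n) := by
    funext n
    rw [← hfs]
    congr 1
    push_cast
    ring
  have htsum : ∑' k : ℤ, f (a + h * k) =
      ∑' n : ℕ, f (a + h * n) + ∑' n : ℕ, f (h - a + h * n) := by
    have := tsum_of_nat_of_neg_add_one (f := fun k : ℤ => f (a + h * k)) (by simpa using hs1)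
      (by rw [hneg]; exact hs2)
    rw [hneg] at this
    simpa using this
  have hint : ∫ x, f x = 2 * ∫ x in Ioi 0, f x := by
    rw [← integral_comp_abs]
    refine integral_congr_ae (.of_forall fun x => ?_)
    rcases abs_choice x with hx | hx <;> simp [hx, hfs]
  have hfa := mul_le_mul_of_nonneg_left (hfu (mem_Ici.2 le_rfl) (mem_Ici.2 ha0) ha0) hb0
  have hfb := mul_le_mul_of_nonneg_left (hfu (mem_Ici.2 le_rfl) (mem_Ici.2 hb0) hb0) ha0
  rw [hshift, htsum, hint, abs_le]
  constructor <;> linarith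

/-- Bounds (20)–(21) of the paper: for a symmetric unimodal density `f`,
the function `F(y) = (1/M) Σ_{k∈ℤ} f(y + k A/M + A/(2M))` satisfies
`|F(y) − 1/A| ≤ f(0)/M`, hence
`(1/A)(1 − (A/M) f(0)) ≤ F(y) ≤ (1/A)(1 + (A/M) f(0))`, for every `y`. -/
theorem output_density_bounds
    (f : ℝ → ℝ) (hf0 : ∀ x : ℝ, 0 ≤ f x) (hfm : Measurable f)
    (hf1 : (∫ x : ℝ, f x) = 1)
    (hfs : ∀ x : ℝ, f (-x) = f x)
    (hfu : AntitoneOn f (Set.Ici (0 : ℝ)))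
    (A : ℝ) (hA : 0 < A) (M : ℕ) (hM : 1 ≤ M) :
    ∀ y : ℝ,
      |(1 / M) * (∑' k : ℤ, f (y + (k : ℝ) * (A / M) + A / (2 * M))) - 1 / A|
          ≤ f 0 / M
      ∧ (1 / A) * (1 - (A / M) * f 0)
          ≤ (1 / M) * (∑' k : ℤ, f (y + (k : ℝ) * (A / M) + A / (2 * M)))
      ∧ (1 / M) * (∑' k : ℤ, f (y + (k : ℝ) * (A / M) + A / (2 * M)))
          ≤ (1 / A) * (1 + (A / M) * f 0) := by
  intro y
  have hM0 : (0 : ℝ) < M := by exact_mod_cast hM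
  have hfi : Integrable f := by
    by_contra hn
    rw [integral_undef hn] at hf1
    exact zero_ne_one hf1
  have key := abs_riemann_sum_sub_integral_le hf0 hfi hfs hfu (y + A / (2 * M)) (div_pos hA hM0)
  have hcomm : ∀ k : ℤ, y + A / (2 * M) + k * (A / M) = y + k * (A / M) + A / (2 * M) :=
    fun k => by ring
  simp only [hcomm, hf1] at key
  set S := ∑' k : ℤ, f (y + (k : ℝ) * (A / M) + A / (2 * M))
  have hbound : |(1 / M) * S - 1 / A| ≤ f 0 / M := by
    have hfactor : (1 / M) * S - 1 / A = A⁻¹ * (A / M * S - 1) := by field_simp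
    rw [hfactor, abs_mul, abs_of_pos (inv_pos.2 hA)]
    calc A⁻¹ * |A / M * S - 1| ≤ A⁻¹ * (A / M * f 0) := by gcongr
      _ = f 0 / M := by field_simp
  have hexpand : 1 / A * (A / M * f 0) = f 0 / M := by field_simp
  obtain ⟨h1, h2⟩ := abs_le.1 hbound
  refine ⟨hbound, ?_, ?_⟩
  · rw [mul_sub, hexpand]
    linarith
  · rw [mul_add, hexpand]
    linarith
end

section
/- Let f : ℝ → ℝ be a probability density function that is symmetric (f(−x) = f(x)) and unimodal (nonincreasing on [0, ∞)). Let A > 0 be real and, for each integer M ≥ 1, define F_M(y) = (1/M) Σ_{k∈ℤ} f( y + k·A/M + A/(2M) ) for y ∈ [−A/2, A/2) and F_M(y) = 0 otherwise. Then the differential entropies h(F_M) = ∫_{−A/2}^{A/2} −F_M(y) log F_M(y) dy satisfy lim_{M→∞} h(F_M) = log A. -/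
open MeasureTheory

/-- The density at `y ∈ [-A/2, A/2)` of the modulo-`A` reduction of `U + Z'`,
where `U` is uniform on `M` points spaced `A/M` apart in `[-A/2, A/2)` and `Z'`
has density `f`; the density is `0` outside `[-A/2, A/2)`. -/
noncomputable def outDensity (f : ℝ → ℝ) (A : ℝ) (M : ℕ) (y : ℝ) : ℝ :=
  if y ∈ Set.Ico (-(A / 2)) (A / 2) then
    (1 / M) * ∑' k : ℤ, f (y + (k : ℝ) * (A / M) + A / (2 * M))
  else 0

open Set in
/-- Shifted integral test: sampling an antitone function at `x, x + 1, x + 2, …` with `x ≥ 0`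
yields a summable sequence. -/
lemma AntitoneOn.summable_add_natCast {g : ℝ → ℝ} (hg : AntitoneOn g (Ici 0))
    (hg0 : ∀ t, 0 ≤ g t) (hgi : IntegrableOn g (Ioi 0)) {x : ℝ} (hx : 0 ≤ x) :
    Summable fun n : ℕ => g (x + n) :=
  (hg.summable_of_integrableOn_Ioi_zero hgi fun t _ => hg0 t).of_nonneg_of_le (fun _ => hg0 _)
    fun n => hg (mem_Ici.2 n.cast_nonneg) (mem_Ici.2 (by positivity)) (by linarith)

open Set in
/-- Shifted integral test: the sum of the samples of an antitone function at `x, x + 1, x + 2, …`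
with `x ∈ [0, 1]` differs from the integral by at most the value at `0`. -/
lemma AntitoneOn.abs_tsum_add_natCast_sub_integral_le {g : ℝ → ℝ} (hg : AntitoneOn g (Ici 0))
    (hg0 : ∀ t, 0 ≤ g t) (hgi : IntegrableOn g (Ioi 0)) {x : ℝ} (hx : x ∈ Icc (0 : ℝ) 1) :
    |(∑' n : ℕ, g (x + n)) - ∫ t in Ioi 0, g t| ≤ g 0 := by
  have hs : Summable fun n : ℕ => g n :=
    hg.summable_of_integrableOn_Ioi_zero hgi fun t _ => hg0 t
  have hsx := hg.summable_add_natCast hg0 hgi hx.1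
  have upper : ∑' n : ℕ, g (x + n) ≤ ∑' n : ℕ, g n :=
    hsx.tsum_le_tsum (fun n => hg (mem_Ici.2 n.cast_nonneg)
      (mem_Ici.2 (add_nonneg hx.1 n.cast_nonneg)) (by linarith [hx.1])) hs
  have lower : ∑' n : ℕ, g (n + 1 : ℕ) ≤ ∑' n : ℕ, g (x + n) :=
    ((summable_nat_add_iff 1).2 hs).tsum_le_tsum (fun n => hg
      (mem_Ici.2 (add_nonneg hx.1 n.cast_nonneg)) (mem_Ici.2 (Nat.cast_nonneg _))
      (by push_cast; linarith [hx.2])) hsx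
  have split := hs.tsum_eq_zero_add
  have le_int := hg.tsum_le_integral hgi fun t _ => hg0 t
  have int_le := hg.integral_le_tsum hs fun t _ => hg0 t
  rw [Nat.cast_zero] at split
  rw [abs_le]
  constructor <;> linarith

open Set in
/-- The sum of an even function that is antitone on `[0, ∞)` over any translate of `ℤ` differs
from its integral by at most twice its value at `0`. -/
lemma abs_tsum_add_intCast_sub_integral_le {g : ℝ → ℝ} (hg : AntitoneOn g (Ici 0))
    (hg0 : ∀ t, 0 ≤ g t) (hgi : Integrable g) (hgs : ∀ t, g (-t) = g t) (x : ℝ) :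
    |(∑' k : ℤ, g (x + k)) - ∫ t, g t| ≤ 2 * g 0 := by
  have shift : ∑' k : ℤ, g (x + k) = ∑' k : ℤ, g (Int.fract x + k) := by
    rw [← (Equiv.addRight ⌊x⌋).tsum_eq fun k : ℤ => g (Int.fract x + k)]
    refine tsum_congr fun k => congrArg g ?_
    rw [Equiv.coe_addRight, Int.cast_add, Int.fract]
    ring
  have h0 := Int.fract_nonneg x
  have h1 := (Int.fract_lt_one x).le
  have neg (n : ℕ) : g (Int.fract x + ((-(n + 1) : ℤ) : ℝ)) = g (1 - Int.fract x + n) := by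
    rw [← hgs]
    congr 1
    push_cast
    ring
  have split : ∑' k : ℤ, g (Int.fract x + k)
      = (∑' n : ℕ, g (Int.fract x + n)) + ∑' n : ℕ, g (1 - Int.fract x + n) := by
    rw [tsum_of_nat_of_neg_add_one]
    · simp only [neg, Int.cast_natCast]
    · simpa using hg.summable_add_natCast hg0 hgi.integrableOn h0
    · simpa only [neg] using hg.summable_add_natCast hg0 hgi.integrableOn (sub_nonneg.2 h1)
  have int : ∫ t, g t = 2 * ∫ t in Ioi 0, g t := by
    rw [← integral_comp_abs]
    refine integral_congr_ae (.of_forall fun t => ?_)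
    rcases abs_choice t with h | h <;> simp [h, hgs]
  have pos := abs_le.1 (hg.abs_tsum_add_natCast_sub_integral_le hg0 hgi.integrableOn ⟨h0, h1⟩)
  have neg := abs_le.1 (hg.abs_tsum_add_natCast_sub_integral_le hg0 hgi.integrableOn
    (x := 1 - Int.fract x) ⟨sub_nonneg.2 h1, by linarith⟩)
  rw [shift, split, int, abs_le]
  constructor <;> linarith [pos.1, pos.2, neg.1, neg.2]

lemma outDensity_nonneg {f : ℝ → ℝ} (hf0 : ∀ x : ℝ, 0 ≤ f x) (A : ℝ) (M : ℕ) (y : ℝ) :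
    0 ≤ outDensity f A M y := by
  unfold outDensity
  split_ifs
  · exact mul_nonneg (by positivity) (tsum_nonneg fun _ => hf0 _)
  · exact le_rfl

lemma measurable_outDensity {f : ℝ → ℝ} (hfm : Measurable f) (A : ℝ) (M : ℕ) :
    Measurable (outDensity f A M) := by
  unfold outDensity
  refine Measurable.ite measurableSet_Ico ?_ measurable_const
  exact (Measurable.tsum fun k => by fun_prop).const_mul _

/-- The output density is uniformly within `2 f(0) / M` of the uniform density. -/
lemma abs_outDensity_sub_le {f : ℝ → ℝ} (hf0 : ∀ x : ℝ, 0 ≤ f x)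
    (hf1 : (∫ x : ℝ, f x) = 1) (hfs : ∀ x : ℝ, f (-x) = f x)
    (hfu : AntitoneOn f (Set.Ici (0 : ℝ))) {A : ℝ} (hA : 0 < A) {M : ℕ} (hM : 0 < M) {y : ℝ}
    (hy : y ∈ Set.Ico (-(A / 2)) (A / 2)) :
    |outDensity f A M y - 1 / A| ≤ 2 * f 0 / M := by
  have hM' : (0 : ℝ) < M := by exact_mod_cast hM
  have hd : 0 < A / M := by positivity
  have hfi : Integrable f := Integrable.of_integral_ne_zero (by simp [hf1])
  have key := abs_tsum_add_intCast_sub_integral_le (g := fun t => f (A / M * t))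
    (fun s hs t ht hst => hfu (Set.mem_Ici.2 (mul_nonneg hd.le hs))
      (Set.mem_Ici.2 (mul_nonneg hd.le ht)) (mul_le_mul_of_nonneg_left hst hd.le))
    (fun t => hf0 _) (hfi.comp_mul_left' hd.ne') (fun t => by rw [mul_neg, hfs])
    (y / (A / M) + 1 / 2)
  rw [Measure.integral_comp_mul_left, hf1, abs_of_pos (inv_pos.2 hd), mul_zero] at key
  have arg (k : ℤ) : A / M * (y / (A / M) + 1 / 2 + k) = y + k * (A / M) + A / (2 * M) := by
    field_simp
    ring
  simp only [arg] at key
  have scale : outDensity f A M y - 1 / A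
      = 1 / M * ((∑' k : ℤ, f (y + k * (A / M) + A / (2 * M))) - (A / M)⁻¹ • 1) := by
    rw [outDensity, if_pos hy, smul_eq_mul, mul_sub]
    congr 1
    field_simp
  rw [scale, abs_mul, abs_of_pos (by positivity), one_div_mul_eq_div]
  gcongr

/-- The differential entropy of the output density `F_M` tends to `log A`
as `M → ∞` (result (23) of the paper). -/
theorem entropy_tendsto_log_A
    (f : ℝ → ℝ) (hf0 : ∀ x : ℝ, 0 ≤ f x) (hfm : Measurable f)
    (hf1 : (∫ x : ℝ, f x) = 1)
    (hfs : ∀ x : ℝ, f (-x) = f x)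
    (hfu : AntitoneOn f (Set.Ici (0 : ℝ)))
    (A : ℝ) (hA : 0 < A) :
    Filter.Tendsto
      (fun M : ℕ =>
        ∫ y in (-(A / 2))..(A / 2),
          -(outDensity f A M y * Real.log (outDensity f A M y)))
      Filter.atTop (nhds (Real.log A)) := by
  have hM : Filter.Tendsto (fun M : ℕ => 2 * f 0 / M) Filter.atTop (nhds 0) :=
    tendsto_const_div_atTop_nhds_zero_nat _
  have limit : ∫ _y in (-(A / 2))..(A / 2), Real.negMulLog (1 / A) = Real.log A := by
    rw [intervalIntegral.integral_const, Real.negMulLog, one_div, Real.log_inv, smul_eq_mul]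
    field_simp
    ring
  obtain ⟨C, hC⟩ := (isCompact_Icc (a := 0) (b := 1 / A + 2 * f 0)).exists_bound_of_continuousOn
    Real.continuous_negMulLog.continuousOn
  have mem : ∀ᵐ y : ℝ, y ∈ Set.uIoc (-(A / 2)) (A / 2) → y ∈ Set.Ico (-(A / 2)) (A / 2) := by
    filter_upwards [Measure.ae_ne volume (A / 2)] with y hne hy
    rw [Set.uIoc_of_le (by linarith)] at hy
    exact ⟨hy.1.le, lt_of_le_of_ne hy.2 hne⟩
  simp only [← neg_mul]
  change Filter.Tendsto (fun M : ℕ => ∫ y in (-(A / 2))..(A / 2),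
    Real.negMulLog (outDensity f A M y)) Filter.atTop _
  rw [← limit]
  refine intervalIntegral.tendsto_integral_filter_of_dominated_convergence (fun _ => C) ?_ ?_
    intervalIntegrable_const ?_
  · exact .of_forall fun M => (Real.continuous_negMulLog.measurable.comp
      (measurable_outDensity hfm A M)).aestronglyMeasurable
  · filter_upwards [Filter.eventually_ge_atTop 1] with M hM1
    filter_upwards [mem] with y hmem hy
    refine hC _ ⟨outDensity_nonneg hf0 A M y, ?_⟩
    have close := (abs_le.1 (abs_outDensity_sub_le hf0 hf1 hfs hfu hA hM1 (hmem hy))).2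
    have : 2 * f 0 / M ≤ 2 * f 0 :=
      div_le_self (by linarith [hf0 0]) (by exact_mod_cast hM1)
    linarith
  · filter_upwards [mem] with y hmem hy
    refine (Real.continuous_negMulLog.tendsto _).comp (tendsto_iff_dist_tendsto_zero.2 ?_)
    refine squeeze_zero' (.of_forall fun _ => dist_nonneg) ?_ hM
    filter_upwards [Filter.eventually_ge_atTop 1] with M hM1
    exact abs_outDensity_sub_le hf0 hf1 hfs hfu hA hM1 (hmem hy)
end
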